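/- arXiv:math/0508380 — 3 statements merged into one kernel-verified Lean document; each statement's English description precedes it below -/
import Mathlib

section
/- If X = A ∪ B where A and B are open, A and B are simply connected, and A ∩ B has exactly two path components, both nonempty and path-connected, then π_1(X) is an infinite cyclic group (free of rank 1). -/
open Set
open scoped unitInterval

/-- The bundle with fibre `ℤ` glued from trivial bundles over the sets of an open cover along the
coboundary of a family of (possibly discontinuous) functions `k i`. -/
noncomputable def coboundaryBundleCore {X ι : Type*} [TopologicalSpace X] (U : ι → Set X)
    (hU : ∀ i, IsOpen (U i)) (hcov : ∀ x, ∃ i, x ∈ U i) (k : ι → X → ℤ)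
    (hk : ∀ i j, ContinuousOn (fun x ↦ k j x - k i x) (U i ∩ U j)) :
    FiberBundleCore ι X ℤ where
  baseSet := U
  isOpen_baseSet := hU
  indexAt x := (hcov x).choose
  mem_baseSet_at x := (hcov x).choose_spec
  coordChange i j x n := n + (k j x - k i x)
  coordChange_self i x _ v := by simp
  continuousOn_coordChange i j :=
    continuousOn_snd.add ((hk i j).comp continuousOn_fst fun _ hp ↦ hp.1)
  coordChange_comp i j l x _ v := by ring

/-- Over the base set of a trivialization with discrete fibre, lifts of paths have constant
fibre coordinate. -/
theorem IsCoveringMap.monodromy_trivialization_snd {E X F : Type*} [TopologicalSpace E]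
    [TopologicalSpace X] [TopologicalSpace F] [DiscreteTopology F] {p : E → X}
    (cov : IsCoveringMap p) (e : Bundle.Trivialization F p) {x y : X} (γ : Path x y)
    (hγ : ∀ t, γ t ∈ e.baseSet) (z : p ⁻¹' {x}) :
    (e (cov.monodromy (.mk γ) z).1).2 = (e z.1).2 := by
  have h₀ : γ 0 = p z.1 := γ.source.trans z.2.symm
  have hlift (t : I) : p (cov.liftPath γ z.1 h₀ t) = γ t := congr_fun (cov.liftPath_lifts ..) t
  have hcont : Continuous fun t ↦ (e (cov.liftPath γ z.1 h₀ t)).2 :=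
    continuous_snd.comp <| e.continuousOn_toFun.comp_continuous
      (cov.liftPath γ z.1 h₀).continuous fun t ↦ by
        rw [e.source_eq, mem_preimage, hlift]; exact hγ t
  have := PreconnectedSpace.constant inferInstance hcont (x := 1) (y := 0)
  rw [cov.liftPath_zero] at this
  exact this

/-- A coboundary `k j - k i` that is continuous on overlaps determines an action of the fundamental
groupoid on `ℤ`, in which a path inside `U i` acts as translation by the drop of `k i`. -/
theorem exists_monodromy_of_coboundary {X ι : Type*} [TopologicalSpace X] (U : ι → Set X)
    (hU : ∀ i, IsOpen (U i)) (hcov : ∀ x, ∃ i, x ∈ U i) (k : ι → X → ℤ)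
    (hk : ∀ i j, ContinuousOn (fun x ↦ k j x - k i x) (U i ∩ U j)) :
    ∃ T : ∀ {x y : X}, Path.Homotopic.Quotient x y → ℤ → ℤ,
      (∀ x n, T (.refl x) n = n) ∧
      (∀ {x y z : X} (γ : Path.Homotopic.Quotient x y) (δ : Path.Homotopic.Quotient y z) (n : ℤ),
        T (γ.trans δ) n = T δ (T γ n)) ∧
      ∀ i {x y : X} (γ : Path x y), (∀ t, γ t ∈ U i) →
        ∀ n, T (.mk γ) n = n + (k i x - k i y) := by
  let Z := coboundaryBundleCore U hU hcov k hk
  have cov : IsCoveringMap Z.proj := FiberBundle.isCoveringMap (F := ℤ) (E := Z.Fiber)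
  let pt (x : X) (n : ℤ) : Z.proj ⁻¹' {x} := ⟨⟨x, n + k (Z.indexAt x) x⟩, rfl⟩
  let co (x : X) (z : Z.proj ⁻¹' {x}) : ℤ := id (α := ℤ) z.1.2 - k (Z.indexAt z.1.1) z.1.1
  have pt_co (x : X) (z : Z.proj ⁻¹' {x}) : pt x (co x z) = z := by
    obtain ⟨⟨x', v⟩, rfl⟩ := z
    exact Subtype.ext (congrArg (Bundle.TotalSpace.mk x') (sub_add_cancel (G := ℤ) _ _))
  have co_pt (x : X) (n : ℤ) : co x (pt x n) = n := add_sub_cancel_right (G := ℤ) _ _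
  have triv (i : ι) (x : X) (z : Z.proj ⁻¹' {x}) : (Z.localTriv i z.1).2 = co x z + k i x := by
    obtain ⟨⟨x', v⟩, rfl⟩ := z
    change id (α := ℤ) v + (k i x' - k (Z.indexAt x') x') =
      id (α := ℤ) v - k (Z.indexAt x') x' + k i x'
    ring
  refine ⟨fun {x y} γ n ↦ co y (cov.monodromy γ (pt x n)), fun x n ↦ ?_, fun γ δ n ↦ ?_,
    fun i x y γ hγ n ↦ ?_⟩
  · simp only [cov.monodromy_refl, id, co_pt]
  · simp only [cov.monodromy_trans_apply, pt_co]
  · have := cov.monodromy_trivialization_snd (Z.localTriv i) γ hγ (pt x n)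
    rw [triv, triv, co_pt] at this
    dsimp only
    linarith

/-- Induction principle for homotopy classes of paths: subdivide along an open cover. -/
theorem Path.Homotopic.Quotient.induction_of_open_cover {X ι : Type*} [TopologicalSpace X]
    (U : ι → Set X) (hU : ∀ i, IsOpen (U i)) (hcov : ∀ x, ∃ i, x ∈ U i)
    {P : ∀ {x y : X}, Path.Homotopic.Quotient x y → Prop} (refl : ∀ x, P (.refl x))
    (trans : ∀ {x y z : X} (γ : Path.Homotopic.Quotient x y) (δ : Path.Homotopic.Quotient y z),
      P γ → P δ → P (γ.trans δ))
    (of_subset : ∀ i {x y : X} (γ : Path x y), (∀ t, γ t ∈ U i) → P (.mk γ))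
    {x y : X} (γ : Path.Homotopic.Quotient x y) : P γ := by
  induction γ using Path.Homotopic.Quotient.ind with | mk γ
  obtain ⟨t, t_zero, t_mono, ⟨N, hN⟩, ht⟩ := exists_monotone_Icc_subset_open_cover_unitInterval
    (fun i ↦ (hU i).preimage γ.continuous) fun s _ ↦ mem_iUnion.2 (hcov (γ s))
  have key (n : ℕ) : P (.mk (γ.subpath (t 0) (t n))) := by
    induction n with
    | zero => rw [Path.subpath_self]; exact refl _
    | succ n ih =>
      rw [← Path.Homotopic.Quotient.eq.2 ⟨Path.Homotopy.subpathTransSubpath γ _ (t n) _⟩]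
      obtain ⟨i, hi⟩ := ht n
      refine trans _ _ ih (of_subset i _ fun s ↦ ?_)
      have : γ.subpath (t n) (t (n + 1)) s ∈ range (γ.subpath (t n) (t (n + 1))) := ⟨s, rfl⟩
      rw [Path.range_subpath_of_le _ _ _ (t_mono n.le_succ)] at this
      obtain ⟨r, hr, hr'⟩ := this
      exact hr' ▸ hi hr
  have h := key N
  rw [t_zero, hN N le_rfl, Path.subpath_zero_one] at h
  have of_cast {x' y' : X} (hx : x' = x) (hy : y' = y) (h : P (.mk (γ.cast hx hy))) :
      P (.mk γ) := by
    subst hx hy; exact h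
  exact of_cast _ _ h

/-- Paths with common endpoints inside a simply connected subset are homotopic. -/
theorem IsSimplyConnected.mk_eq_mk {X : Type*} [TopologicalSpace X] {S : Set X}
    (hS : IsSimplyConnected S) {x y : X} {γ δ : Path x y} (hγ : ∀ t, γ t ∈ S) (hδ : ∀ t, δ t ∈ S) :
    Path.Homotopic.Quotient.mk γ = .mk δ := by
  have := hS.simplyConnectedSpace
  let lift (γ : Path x y) (hγ : ∀ t, γ t ∈ S) :
      Path (⟨x, γ.source ▸ hγ 0⟩ : S) ⟨y, γ.target ▸ hγ 1⟩ :=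
    { toFun := fun t ↦ ⟨γ t, hγ t⟩
      source' := by simp
      target' := by simp }
  exact Path.Homotopic.Quotient.eq.2
    ((SimplyConnectedSpace.paths_homotopic (lift γ hγ) (lift δ hδ)).map ⟨_, continuous_subtype_val⟩)

theorem Path.trans_apply_mem {X : Type*} [TopologicalSpace X] {S : Set X} {x y z : X}
    {γ : Path x y} {δ : Path y z} (hγ : ∀ t, γ t ∈ S) (hδ : ∀ t, δ t ∈ S) (t : I) :
    γ.trans δ t ∈ S := by
  have : γ.trans δ t ∈ range (γ.trans δ) := ⟨t, rfl⟩
  rw [Path.trans_range] at this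
  rcases this with ⟨s, hs⟩ | ⟨s, hs⟩
  exacts [hs ▸ hγ s, hs ▸ hδ s]

/-- The loop running to `x` inside `U` along `ρ` and back inside `V` along `δ` depends only on the
path component of `x` in `U ∩ V`. -/
theorem trans_symm_eq_of_joinedIn {X : Type*} [TopologicalSpace X] {U V : Set X}
    (hU : IsSimplyConnected U) (hV : IsSimplyConnected V) {c x y : X} {ρ : Path c x} {ρ' : Path c y}
    {δ : Path c x} {δ' : Path c y} (hρ : ∀ t, ρ t ∈ U) (hρ' : ∀ t, ρ' t ∈ U) (hδ : ∀ t, δ t ∈ V)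
    (hδ' : ∀ t, δ' t ∈ V) (hxy : JoinedIn (U ∩ V) x y) :
    (Path.Homotopic.Quotient.mk ρ).trans (.symm (.mk δ)) =
      (Path.Homotopic.Quotient.mk ρ').trans (.symm (.mk δ')) := by
  obtain ⟨τ, hτ⟩ := hxy
  rw [hU.mk_eq_mk hρ' (Path.trans_apply_mem hρ fun t ↦ (hτ t).1),
    hV.mk_eq_mk hδ' (Path.trans_apply_mem hδ fun t ↦ (hτ t).2)]
  change _ = Path.Homotopic.Quotient.mk _
  rw [Path.trans_symm]
  simp only [Path.Homotopic.Quotient.mk_trans, Path.Homotopic.Quotient.mk_symm,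
    Path.Homotopic.Quotient.trans_assoc]
  rw [← Path.Homotopic.Quotient.trans_assoc (.mk τ)]
  simp

/-- Suppose an open cover has simply connected members containing `c`, joined to each point by paths
`ρ` from `c`. A subgroup of the fundamental group containing all loops that run to a point inside
one member and back inside another is everything. -/
theorem subgroup_eq_top_of_open_cover {X ι : Type*} [TopologicalSpace X]
    (U : ι → Set X) (hU : ∀ i, IsOpen (U i)) (hcov : ∀ x, ∃ i, x ∈ U i)
    (hsc : ∀ i, IsSimplyConnected (U i)) {c : X}
    (ρ : ∀ i x, x ∈ U i → Path c x) (hρ : ∀ i x hx t, ρ i x hx t ∈ U i)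
    (H : Subgroup (FundamentalGroup X c))
    (hH : ∀ i j x hi hj, FundamentalGroup.fromPath
      ((Path.Homotopic.Quotient.mk (ρ i x hi)).trans (.symm (.mk (ρ j x hj)))) ∈ H) :
    H = ⊤ := by
  have key {x y : X} (γ : Path.Homotopic.Quotient x y) : ∀ i j hi hj, FundamentalGroup.fromPath
      ((Path.Homotopic.Quotient.mk (ρ i x hi)).trans (γ.trans (.symm (.mk (ρ j y hj))))) ∈ H := by
    refine Path.Homotopic.Quotient.induction_of_open_cover U hU hcov
      (P := fun {x y} γ ↦ ∀ i j hi hj, FundamentalGroup.fromPath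
        ((Path.Homotopic.Quotient.mk (ρ i x hi)).trans (γ.trans (.symm (.mk (ρ j y hj))))) ∈ H)
      ?_ ?_ ?_ γ
    · intro x i j hi hj
      rw [Path.Homotopic.Quotient.refl_trans]
      exact hH i j x hi hj
    · intro x y z γ δ hγ hδ i j hi hj
      obtain ⟨l, hl⟩ := hcov y
      convert H.mul_mem (hδ l j hl hj) (hγ i l hi hl) using 1
      rw [FundamentalGroup.mul_def]
      simp only [Path.Homotopic.Quotient.trans_assoc]
      rw [← Path.Homotopic.Quotient.trans_assoc (.symm (.mk (ρ l y hl)))]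
      simp
    · intro l x y γ hγ i j hi hj
      have hx : x ∈ U l := γ.source ▸ hγ 0
      have hy : y ∈ U l := γ.target ▸ hγ 1
      have h := (hsc l).mk_eq_mk (hρ l y hy) (Path.trans_apply_mem (hρ l x hx) hγ)
      convert H.mul_mem (hH l j y hy hj) (hH i l x hi hx) using 1
      rw [FundamentalGroup.mul_def, h, Path.Homotopic.Quotient.mk_trans]
      simp only [Path.Homotopic.Quotient.trans_assoc]
      rw [← Path.Homotopic.Quotient.trans_assoc (.symm (.mk (ρ l x hx)))]
      simp
  refine (Subgroup.eq_top_iff' H).2 fun γ ↦ ?_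
  obtain ⟨i, hi⟩ := hcov c
  have h : Path.Homotopic.Quotient.mk (ρ i c hi) = .refl c :=
    (hsc i).mk_eq_mk (hρ i c hi) (δ := .refl c) fun _ ↦ hi
  have := key γ i i hi hi
  rw [h, Path.Homotopic.Quotient.refl_trans] at this
  exact (H.mul_mem_cancel_left H.one_mem).1 this

/-- if `X = A ∪ B` with `A, B` open and simply connected, and `A ∩ B` has
exactly two path components (both nonempty, open, path-connected), then `π₁(X)` is
infinite cyclic. -/
theorem pi1_infinite_cyclic_of_two_component_intersection (X : Type) [TopologicalSpace X]
    (A B C₀ C₁ : Set X) (hAopen : IsOpen A) (hBopen : IsOpen B) (hcover : A ∪ B = Set.univ)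
    (hAsc : SimplyConnectedSpace ↥A) (hBsc : SimplyConnectedSpace ↥B)
    (hC₀open : IsOpen C₀) (hC₁open : IsOpen C₁)
    (hC₀ne : C₀.Nonempty) (hC₁ne : C₁.Nonempty)
    (hC₀pc : IsPathConnected C₀) (hC₁pc : IsPathConnected C₁)
    (hdisj : Disjoint C₀ C₁) (hinter : A ∩ B = C₀ ∪ C₁)
    (c : X) (hc : c ∈ C₀) :
    Nonempty (FundamentalGroup X c ≃* Multiplicative ℤ) := by
  obtain ⟨d, hd⟩ := hC₁ne
  have hcAB : c ∈ A ∩ B := hinter ▸ .inl hc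
  have hdAB : d ∈ A ∩ B := hinter ▸ .inr hd
  let U (i : Bool) : Set X := cond i B A
  have hU : ∀ i, IsOpen (U i) := Bool.forall_bool.2 ⟨hAopen, hBopen⟩
  have hcov (x : X) : ∃ i, x ∈ U i := Bool.exists_bool.2 (hcover ▸ mem_univ x : x ∈ A ∪ B)
  have hsc : ∀ i, IsSimplyConnected (U i) := Bool.forall_bool.2 ⟨hAsc, hBsc⟩
  have hcU : ∀ i, c ∈ U i := Bool.forall_bool.2 hcAB
  choose ρ hρ using fun i x (hx : x ∈ U i) ↦ (hsc i).isPathConnected.joinedIn c (hcU i) x hx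
  let loop (i j : Bool) (x : X) (hi : x ∈ U i) (hj : x ∈ U j) : FundamentalGroup X c :=
    .fromPath ((Path.Homotopic.Quotient.mk (ρ i x hi)).trans (.symm (.mk (ρ j x hj))))
  have loop_self (i x hi) : loop i i x hi hi = 1 := Path.Homotopic.Quotient.trans_symm _
  have loop_c : loop false true c hcAB.1 hcAB.2 = 1 := by
    have h (i : Bool) : Path.Homotopic.Quotient.mk (ρ i c (hcU i)) = .refl c :=
      (hsc i).mk_eq_mk (hρ i c (hcU i)) (δ := .refl c) fun _ ↦ hcU i
    simp only [loop, h]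
    exact Path.Homotopic.Quotient.trans_symm _
  have loop_joined {x y : X} {C : Set X} (hC : IsPathConnected C) (hCAB : C ⊆ A ∩ B) (hx : x ∈ C)
      (hy : y ∈ C) : loop false true x (hCAB hx).1 (hCAB hx).2 =
        loop false true y (hCAB hy).1 (hCAB hy).2 :=
    trans_symm_eq_of_joinedIn (hsc false) (hsc true) (hρ _ _ _) (hρ _ _ _) (hρ _ _ _) (hρ _ _ _)
      ((hC.joinedIn x hx y hy).mono hCAB)
  let g := loop false true d hdAB.1 hdAB.2
  have loop_mem (x : X) (hA : x ∈ A) (hB : x ∈ B) :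
      loop false true x hA hB ∈ Subgroup.zpowers g := by
    have hx : x ∈ C₀ ∪ C₁ := hinter ▸ ⟨hA, hB⟩
    rcases hx with hx | hx
    · rw [loop_joined hC₀pc (hinter ▸ subset_union_left) hx hc, loop_c]
      exact one_mem _
    · rw [loop_joined hC₁pc (hinter ▸ subset_union_right) hx hd]
      exact Subgroup.mem_zpowers g
  have htop : Subgroup.zpowers g = ⊤ := by
    refine subgroup_eq_top_of_open_cover U hU hcov hsc ρ hρ _ fun i j x hi hj ↦ ?_
    change loop i j x hi hj ∈ _
    match i, j with
    | false, false | true, true => rw [loop_self]; exact one_mem _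
    | false, true => exact loop_mem x hi hj
    | true, false =>
      have : loop true false x hi hj = (loop false true x hj hi)⁻¹ := by
        change Path.Homotopic.Quotient.mk ((ρ true x hi).trans (ρ false x hj).symm) =
          .mk ((ρ false x hj).trans (ρ true x hi).symm).symm
        rw [Path.trans_symm, Path.symm_symm]
      rw [this]
      exact inv_mem (loop_mem x hj hi)
  classical
  let k (i : Bool) (x : X) : ℤ := if i ∧ x ∈ C₁ then 1 else 0
  have hk₁ : ContinuousOn (k true) (A ∩ B) := by
    rw [hinter]
    refine ContinuousOn.union_of_isOpen ?_ ?_ hC₀open hC₁open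
    · exact continuousOn_const (c := 0) |>.congr fun x hx ↦ by
        simp [k, hdisj.notMem_of_mem_left hx]
    · exact continuousOn_const (c := 1) |>.congr fun x hx ↦ by simp [k, hx]
  have hk₀ (x : X) : k false x = 0 := by simp [k]
  obtain ⟨T, T_refl, T_trans, T_U⟩ := exists_monodromy_of_coboundary U hU hcov k <| by
    intro i j
    match i, j with
    | false, false | true, true => simpa using continuousOn_const
    | false, true => simp only [hk₀, sub_zero]; exact hk₁
    | true, false => simp only [hk₀, zero_sub]; rw [inter_comm]; exact hk₁.neg
  have T_g (n : ℤ) : T g n = n + 1 := by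
    have h := T_U true (ρ true d hdAB.2).symm (fun t ↦ hρ _ _ _ _)
    have h' := T_U false (ρ false d hdAB.1) (hρ _ _ _)
    refine (T_trans _ _ n).trans ?_
    rw [h']
    refine (h _).trans ?_
    simp [k, hd, hdisj.notMem_of_mem_left hc]
  have T_pow (m : ℕ) : T (g ^ m) 0 = m := by
    induction m with
    | zero => exact T_refl c 0
    | succ m ih =>
      rw [pow_succ']
      refine (T_trans (g ^ m) g 0).trans ?_
      rw [ih, T_g]
      push_cast
      rfl
  have hinj : Function.Injective (zpowersHom _ g) := by
    refine (injective_zpow_iff_not_isOfFinOrder (x := g)).2 fun h ↦ ?_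
    obtain ⟨m, hm, hgm⟩ := isOfFinOrder_iff_pow_eq_one.1 h
    have := T_pow m
    rw [hgm] at this
    have := (T_refl c 0).symm.trans this
    omega
  have hsurj : Function.Surjective (zpowersHom _ g) := by
    intro x
    obtain ⟨n, hn⟩ := Subgroup.mem_zpowers_iff.1 (htop ▸ Subgroup.mem_top x)
    exact ⟨.ofAdd n, hn⟩
  exact ⟨(MulEquiv.ofBijective (zpowersHom _ g) ⟨hinj, hsurj⟩).symm⟩
end

section
/- The n-string braid group of the 1-ray sun graph L_1 (the circle with one attached ray) is a free group of rank n: B_n(L_1, c) ≅ F_n for any base configuration c. -/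
open Set CategoryTheory Complex

open scoped Real

noncomputable section

/-- Ordered configuration space: injective `n`-tuples in `X`
    (the complement of the fat diagonal in `X^n`), with the subspace topology. -/
def OrdConf (n : ℕ) (X : Type*) [TopologicalSpace X] : Type _ :=
  {f : Fin n → X // Function.Injective f}

instance (n : ℕ) (X : Type*) [TopologicalSpace X] : TopologicalSpace (OrdConf n X) :=
  instTopologicalSpaceSubtype

/-- The unordered `n`-point configuration space `U_n^{top}(X)`:
    the set of `n`-element subsets of `X`. -/
def UConf (n : ℕ) (X : Type*) [TopologicalSpace X] : Type _ :=
  {s : Set X // s.Finite ∧ s.ncard = n}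

/-- The natural projection `p : X^n - Δ → U_n^{top}(X)`, `(x_1,…,x_n) ↦ {x_1,…,x_n}`. -/
def confProj (n : ℕ) (X : Type*) [TopologicalSpace X] : OrdConf n X → UConf n X :=
  fun f => ⟨Set.range f.1, Set.finite_range _, by
    rw [← Set.image_univ, Set.ncard_image_of_injective _ f.2, Set.ncard_univ,
      Nat.card_eq_fintype_card, Fintype.card_fin]⟩

/-- `U_n^{top}(X)` carries the quotient topology from `p`. -/
instance (n : ℕ) (X : Type*) [TopologicalSpace X] : TopologicalSpace (UConf n X) :=
  TopologicalSpace.coinduced (confProj n X) inferInstance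

/-- The `j`-th radial arm `A_j = {r·e^{2πij/m} : 1 ≤ r ≤ 2}` of the `m`-ray sun graph. -/
def Arm (m j : ℕ) : Set ℂ :=
  {z | ∃ r : ℝ, 1 ≤ r ∧ r ≤ 2 ∧ z = (r : ℂ) * Complex.exp (2 * Real.pi * j / m * Complex.I)}

/-- The `m`-ray sun graph `L_m = S¹ ∪ A_0 ∪ ⋯ ∪ A_{m-1} ⊆ ℂ`. -/
def Lsun (m : ℕ) : Set ℂ :=
  Metric.sphere (0 : ℂ) 1 ∪ ⋃ j ∈ Finset.range m, Arm m j

section BasedLoops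

open scoped unitInterval

variable {X : Type*} [TopologicalSpace X] {x₀ : X}

/-- The loop at `x₀` obtained by joining the endpoints of the path `γ` to `x₀` along the
tails `l`. -/
def basedLoop (l : ∀ x, Path x₀ x) (γ : C(I, X)) : FundamentalGroup X x₀ :=
  FundamentalGroup.fromPath (((Path.Homotopic.Quotient.mk (l (γ 0))).trans
    (.mk ⟨γ, rfl, rfl⟩)).trans (Path.Homotopic.Quotient.mk (l (γ 1))).symm)

variable (l : ∀ x, Path x₀ x)

theorem basedLoop_path {x y : X} (γ : Path x y) :
    basedLoop l γ.toContinuousMap =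
      FundamentalGroup.fromPath (((Path.Homotopic.Quotient.mk (l x)).trans (.mk γ)).trans
        (Path.Homotopic.Quotient.mk (l y)).symm) := by
  obtain ⟨f, rfl, rfl⟩ := γ
  rfl

theorem Path.Homotopic.Quotient.symm_trans_cancel {x y z : X}
    (p : Path.Homotopic.Quotient x y) (q : Path.Homotopic.Quotient y z) :
    p.symm.trans (p.trans q) = q := by
  rw [← Path.Homotopic.Quotient.trans_assoc, Path.Homotopic.Quotient.symm_trans,
    Path.Homotopic.Quotient.refl_trans]

theorem basedLoop_trans {x y z : X} (γ : Path x y) (δ : Path y z) :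
    basedLoop l (γ.trans δ).toContinuousMap =
      basedLoop l δ.toContinuousMap * basedLoop l γ.toContinuousMap := by
  rw [basedLoop_path, basedLoop_path, basedLoop_path, FundamentalGroup.mul_def,
    Path.Homotopic.Quotient.mk_trans]
  simp only [FundamentalGroup.fromPath, FundamentalGroup.fromArrow,
    Path.Homotopic.Quotient.trans_assoc, Path.Homotopic.Quotient.symm_trans_cancel]

theorem basedLoop_homotopic {x y : X} {γ δ : Path x y} (h : γ.Homotopic δ) :
    basedLoop l γ.toContinuousMap = basedLoop l δ.toContinuousMap := by
  rw [basedLoop_path, basedLoop_path, Path.Homotopic.Quotient.eq.2 h]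

theorem basedLoop_const (x : X) : basedLoop l (.const I x) = 1 := by
  have := basedLoop_path l (Path.refl x)
  rw [Path.Homotopic.Quotient.mk_refl, Path.Homotopic.Quotient.trans_refl,
    Path.Homotopic.Quotient.trans_symm] at this
  exact this

theorem basedLoop_loop (hl : (l x₀).Homotopic (Path.refl x₀)) (γ : Path x₀ x₀) :
    basedLoop l γ.toContinuousMap = FundamentalGroup.fromPath (.mk γ) := by
  rw [basedLoop_path, Path.Homotopic.Quotient.eq.2 hl, Path.Homotopic.Quotient.mk_refl,
    Path.Homotopic.Quotient.refl_trans]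
  rw [← Path.Homotopic.Quotient.mk_refl, ← Path.Homotopic.Quotient.mk_symm, Path.refl_symm,
    Path.Homotopic.Quotient.mk_refl, Path.Homotopic.Quotient.trans_refl]

instance contractibleSpace_unitSquare : ContractibleSpace (I × I) :=
  (contractible_iff_id_nullhomotopic _).2 ⟨(0, 0), ⟨
    { toFun := fun p => (σ p.1 * p.2.1, σ p.1 * p.2.2)
      continuous_toFun := by fun_prop
      map_zero_left := by simp
      map_one_left := by simp }⟩⟩

theorem basedLoop_square (H : C(I × I, X)) :
    basedLoop l (H.comp (.prodMk (.const I 1) (.id I))) *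
        basedLoop l (H.comp (.prodMk (.id I) (.const I 0))) =
      basedLoop l (H.comp (.prodMk (.id I) (.const I 1))) *
        basedLoop l (H.comp (.prodMk (.const I 0) (.id I))) := by
  let a : Path ((0 : I), (0 : I)) (1, 0) := ⟨.prodMk (.id I) (.const I 0), rfl, rfl⟩
  let b : Path ((1 : I), (0 : I)) (1, 1) := ⟨.prodMk (.const I 1) (.id I), rfl, rfl⟩
  let c : Path ((0 : I), (0 : I)) (0, 1) := ⟨.prodMk (.const I 0) (.id I), rfl, rfl⟩
  let d : Path ((0 : I), (1 : I)) (1, 1) := ⟨.prodMk (.id I) (.const I 1), rfl, rfl⟩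
  have h : (a.trans b).Homotopic (c.trans d) := SimplyConnectedSpace.paths_homotopic _ _
  have h' := basedLoop_homotopic l (h.map H)
  rw [Path.map_trans, Path.map_trans, basedLoop_trans, basedLoop_trans] at h'
  exact h'

/-- The piece of a path between two parameters. -/
def pathPiece (γ : C(I, X)) (a b : I) : C(I, X) :=
  ((⟨γ, rfl, rfl⟩ : Path (γ 0) (γ 1)).subpath a b).toContinuousMap

theorem pathPiece_apply (γ : C(I, X)) (a b s : I) :
    pathPiece γ a b s = γ (Icc.convexComb a b s) := rfl

theorem basedLoop_mem_of_cover {ι : Type*} {c : ι → Set I} (hc : ∀ i, IsOpen (c i))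
    (hc' : univ ⊆ ⋃ i, c i) (K : Subgroup (FundamentalGroup X x₀)) (γ : C(I, X))
    (h : ∀ i a b, Icc a b ⊆ c i → a ≤ b → basedLoop l (pathPiece γ a b) ∈ K) :
    basedLoop l γ ∈ K := by
  obtain ⟨t, ht0, hmono, ⟨N, hN⟩, ht⟩ := exists_monotone_Icc_subset_open_cover_unitInterval hc hc'
  have key : ∀ k, basedLoop l (pathPiece γ 0 (t k)) ∈ K := by
    intro k
    induction k with
    | zero =>
      have : pathPiece γ 0 (t 0) = .const I (γ 0) := by
        ext s; simp [pathPiece_apply, ht0]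
      rw [this, basedLoop_const]
      exact K.one_mem
    | succ k ih =>
      obtain ⟨i, hi⟩ := ht k
      have h1 := h i _ _ hi (hmono k.le_succ)
      have h2 : basedLoop l (pathPiece γ 0 (t (k + 1))) =
          basedLoop l (pathPiece γ (t k) (t (k + 1))) * basedLoop l (pathPiece γ 0 (t k)) := by
        have := basedLoop_homotopic l
          ⟨Path.Homotopy.subpathTransSubpath ⟨γ, rfl, rfl⟩ 0 (t k) (t (k + 1))⟩
        rw [basedLoop_trans] at this
        exact this.symm
      rw [h2]
      exact K.mul_mem h1 ih
  have := key N
  rw [hN N le_rfl] at this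
  convert this using 2
  ext s
  simp [pathPiece_apply, Icc.convexComb]

end BasedLoops

section SunGraph

open scoped unitInterval Topology

theorem mem_Lsun_one {z : ℂ} :
    z ∈ Lsun 1 ↔ ‖z‖ = 1 ∨ ∃ r : ℝ, 1 ≤ r ∧ r ≤ 2 ∧ z = r := by
  simp [Lsun, Arm]

/-- The parametrisation of `L₁` by `(0, 2]`: the half-open interval `(0, 1]` winds once around the
circle and `[1, 2]` runs along the arm. -/
def sunParam (t : ℝ) : Lsun 1 :=
  ⟨((max 1 (min t 2) : ℝ) : ℂ) * Complex.exp ((2 * π * min t 1 : ℝ) * Complex.I), by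
    rw [mem_Lsun_one]
    rcases le_total t 1 with h | h
    · left
      rw [norm_mul, Complex.norm_exp_ofReal_mul_I, max_eq_left ((min_le_left _ _).trans h)]
      simp
    · right
      refine ⟨max 1 (min t 2), le_max_left _ _, max_le (by norm_num) (min_le_right _ _), ?_⟩
      rw [min_eq_right h, mul_one]
      push_cast
      rw [Complex.exp_two_pi_mul_I, mul_one]⟩

theorem continuous_sunParam : Continuous sunParam := by
  unfold sunParam
  fun_prop

/-- The coordinate on `L₁` inverse to `sunParam`. -/
def sunCoord (z : Lsun 1) : ℝ := ‖(z : ℂ)‖ + Complex.arg (-z) / (2 * π) - 1 / 2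

/-- The vertex of `L₁`, where the arm meets the circle. -/
def sunVertex : Lsun 1 := sunParam 1

theorem sunParam_of_le {t : ℝ} (h : t ≤ 1) :
    (sunParam t : ℂ) = Complex.exp ((2 * π * t : ℝ) * Complex.I) := by
  simp only [sunParam]
  rw [min_eq_left h, max_eq_left ((min_le_left _ _).trans h)]
  simp

theorem sunParam_of_ge {t : ℝ} (h : 1 ≤ t) (h2 : t ≤ 2) : (sunParam t : ℂ) = t := by
  simp only [sunParam]
  rw [min_eq_right h, min_eq_left h2, max_eq_right h, mul_one]
  push_cast
  rw [Complex.exp_two_pi_mul_I, mul_one]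

theorem sunParam_zero : sunParam 0 = sunVertex := by
  ext
  rw [sunVertex, sunParam_of_le zero_le_one, sunParam_of_le le_rfl]
  simp

theorem sunCoord_sunParam {t : ℝ} (h : t ∈ Ioc 0 2) : sunCoord (sunParam t) = t := by
  have hpi := Real.pi_pos
  rcases le_total t 1 with h1 | h1
  · have : -(sunParam t : ℂ) = Complex.exp ((2 * π * t - π : ℝ) * Complex.I) := by
      rw [sunParam_of_le h1]
      push_cast
      rw [sub_mul, Complex.exp_sub, Complex.exp_pi_mul_I, div_neg, div_one]
    rw [sunCoord, this, ← norm_neg, this, Complex.norm_exp_ofReal_mul_I, Complex.arg_exp_mul_I,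
      (toIocMod_eq_self _).2 ⟨by nlinarith [h.1], by nlinarith⟩]
    field_simp
    ring
  · rw [sunCoord, sunParam_of_ge h1 h.2, ← Complex.ofReal_neg,
      Complex.arg_ofReal_of_neg (by linarith), Complex.norm_real, Real.norm_of_nonneg (by linarith)]
    field_simp
    ring

theorem sunCoord_mem_and_sunParam_sunCoord (z : Lsun 1) :
    sunCoord z ∈ Ioc 0 2 ∧ sunParam (sunCoord z) = z := by
  have hpi := Real.pi_pos
  obtain ⟨z, hz⟩ := z
  rcases mem_Lsun_one.1 hz with h | ⟨r, h1, h2, rfl⟩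
  · have hs : sunCoord ⟨z, hz⟩ = 1 / 2 + Complex.arg (-z) / (2 * π) := by
      simp only [sunCoord]; rw [h]; ring
    have h3 := Complex.neg_pi_lt_arg (-z)
    have h4 := Complex.arg_le_pi (-z)
    have h5 : -(1 / 2) < Complex.arg (-z) / (2 * π) := by
      rw [lt_div_iff₀ (by positivity)]; linarith
    have h6 : Complex.arg (-z) / (2 * π) ≤ 1 / 2 := by
      rw [div_le_iff₀ (by positivity)]; linarith
    rw [hs]
    refine ⟨⟨by linarith, by linarith⟩, ?_⟩
    ext
    rw [sunParam_of_le (by linarith)]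
    have h7 : 2 * π * (1 / 2 + Complex.arg (-z) / (2 * π)) = π + Complex.arg (-z) := by
      field_simp
    have h8 := Complex.norm_mul_exp_arg_mul_I (-z)
    rw [norm_neg, h] at h8
    rw [h7]
    push_cast
    rw [add_mul, Complex.exp_add, Complex.exp_pi_mul_I]
    push_cast at h8
    linear_combination -h8
  · have : (⟨(r : ℂ), hz⟩ : Lsun 1) = sunParam r := by
      ext; rw [sunParam_of_ge h1 h2]
    rw [this, sunCoord_sunParam ⟨by linarith, h2⟩]
    exact ⟨⟨by linarith, h2⟩, rfl⟩

theorem sunCoord_mem (z : Lsun 1) : sunCoord z ∈ Ioc 0 2 :=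
  (sunCoord_mem_and_sunParam_sunCoord z).1

theorem sunParam_sunCoord (z : Lsun 1) : sunParam (sunCoord z) = z :=
  (sunCoord_mem_and_sunParam_sunCoord z).2

theorem sunCoord_injective : Function.Injective sunCoord :=
  Function.LeftInverse.injective sunParam_sunCoord

theorem sunCoord_sunVertex : sunCoord sunVertex = 1 := sunCoord_sunParam (by norm_num)

theorem sunCoord_eq_one {z : Lsun 1} : sunCoord z = 1 ↔ z = sunVertex := by
  rw [← sunCoord_sunVertex, sunCoord_injective.eq_iff]

theorem isClosedMap_sunParam_restrict : IsClosedMap (fun t : Icc (0 : ℝ) 2 => sunParam t) :=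
  (continuous_sunParam.comp continuous_subtype_val).isClosedMap

/-- A function of the coordinate which agrees at the two ends of the loop is continuous. -/
theorem continuous_comp_sunCoord {Y : Type*} [TopologicalSpace Y] {F : ℝ → Y}
    (hF : Continuous F) (h01 : F 0 = F 1) : Continuous (F ∘ sunCoord) := by
  have hq : Topology.IsQuotientMap (fun t : Icc (0 : ℝ) 2 => sunParam t) :=
    isClosedMap_sunParam_restrict.isQuotientMap (continuous_sunParam.comp continuous_subtype_val)
      fun z => ⟨⟨sunCoord z, Ioc_subset_Icc_self (sunCoord_mem z)⟩, sunParam_sunCoord z⟩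
  rw [hq.continuous_iff]
  convert hF.comp continuous_subtype_val using 1
  ext ⟨t, ht⟩
  simp only [Function.comp_apply]
  rcases ht.1.eq_or_lt with rfl | h0
  · rw [sunParam_zero, sunCoord_sunVertex, h01]
  · rw [sunCoord_sunParam ⟨h0, ht.2⟩]

theorem continuousAt_sunCoord {z : Lsun 1} (hz : z ≠ sunVertex) : ContinuousAt sunCoord z := by
  rw [ContinuousAt, Filter.tendsto_def]
  intro U hU
  obtain ⟨V, hVU, hV, hzV⟩ := mem_nhds_iff.1 hU
  have hcl := isClosedMap_sunParam_restrict _ ((hV.preimage continuous_subtype_val).isClosed_compl)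
  refine Filter.mem_of_superset (hcl.isOpen_compl.mem_nhds ?_) fun w hw => hVU ?_
  · rintro ⟨⟨t, ht⟩, htV, rfl⟩
    rcases ht.1.eq_or_lt with rfl | h0
    · exact hz sunParam_zero
    · exact htV (by simpa [sunCoord_sunParam ⟨h0, ht.2⟩] using hzV)
  · by_contra hwV
    exact hw ⟨⟨sunCoord w, Ioc_subset_Icc_self (sunCoord_mem w)⟩, hwV, sunParam_sunCoord w⟩

/-- The distance to the vertex in the coordinate `sunCoord`. -/
def vertexDist (t : ℝ) : ℝ := min t |t - 1|

theorem continuous_vertexDist : Continuous vertexDist := by unfold vertexDist; fun_prop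

theorem continuous_vertexDist_sunCoord : Continuous fun z => vertexDist (sunCoord z) :=
  continuous_comp_sunCoord continuous_vertexDist (by simp [vertexDist])

theorem vertexDist_pos {t : ℝ} (h0 : 0 < t) (h1 : t ≠ 1) : 0 < vertexDist t :=
  lt_min h0 (abs_pos.2 (sub_ne_zero.2 h1))

theorem vertexDist_one : vertexDist 1 = 0 := by simp [vertexDist]

/-- The displacement that pulls a point near the vertex into the vertex. -/
def vertexPull (t : ℝ) : ℝ := max (min t (1 / 2 - t)) (t - 1)

theorem continuous_vertexPull : Continuous vertexPull := by unfold vertexPull; fun_prop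

theorem vertexPull_of_lt {t : ℝ} (h : t < 1 / 4) : vertexPull t = t := by
  rw [vertexPull, min_eq_left (by linarith), max_eq_left (by linarith)]

theorem vertexPull_of_gt {t : ℝ} (h : 3 / 4 < t) : vertexPull t = t - 1 := by
  rw [vertexPull, min_eq_right (by linarith), max_eq_right (by linarith)]

/-- The contraction of a neighbourhood of the vertex. -/
def pullToVertex (z : Lsun 1) (s : I) : Lsun 1 :=
  sunParam (sunCoord z - s * vertexPull (sunCoord z))

theorem continuous_pullToVertex : Continuous fun p : Lsun 1 × I => pullToVertex p.1 p.2 := by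
  let F₀ : C(ℝ × I, Lsun 1) := ⟨fun p => sunParam (p.1 - p.2 * vertexPull p.1), by
    have := continuous_vertexPull
    have := continuous_sunParam
    fun_prop⟩
  have h : Continuous (F₀.curry ∘ sunCoord) := continuous_comp_sunCoord F₀.curry.continuous (by
    ext s : 1
    have h0 : vertexPull 0 = 0 := by simp [vertexPull]
    have h1 : vertexPull 1 = 0 := by rw [vertexPull_of_gt] <;> norm_num
    simp [F₀, h0, h1, sunParam_zero, sunVertex])
  exact (ContinuousMap.uncurry ⟨_, h⟩).continuous

theorem pullToVertex_zero (z : Lsun 1) : pullToVertex z 0 = z := by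
  simp [pullToVertex, sunParam_sunCoord]

/-- Points at distance less than `1 / 4` from the vertex lie on the final segment of the loop or
near the vertex in the coordinate. -/
theorem lt_or_lt_of_vertexDist {t : ℝ} (h : vertexDist t < 1 / 4) :
    t < 1 / 4 ∨ (3 / 4 < t ∧ t < 5 / 4) := by
  rcases min_lt_iff.1 h with h | h
  · exact .inl h
  · rw [abs_lt] at h
    exact .inr ⟨by linarith, by linarith⟩

theorem pullToVertex_one {z : Lsun 1} (h : vertexDist (sunCoord z) < 1 / 4) :
    pullToVertex z 1 = sunVertex := by
  rcases lt_or_lt_of_vertexDist h with h | h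
  · rw [pullToVertex, vertexPull_of_lt h]; simp [sunParam_zero]
  · rw [pullToVertex, vertexPull_of_gt h.1]; simp [sunVertex]

theorem sunCoord_pullToVertex_of_gt {z : Lsun 1} (h : 3 / 4 < sunCoord z) (h' : sunCoord z < 5 / 4)
    (s : I) : sunCoord (pullToVertex z s) = sunCoord z - s * (sunCoord z - 1) := by
  have h0 := s.2.1
  have h1 := s.2.2
  rw [pullToVertex, vertexPull_of_gt h, sunCoord_sunParam]
  constructor <;> nlinarith

theorem sunCoord_pullToVertex_of_lt {z : Lsun 1} (h : sunCoord z < 1 / 4) {s : I} (hs : s ≠ 1) :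
    sunCoord (pullToVertex z s) = (1 - s) * sunCoord z := by
  have h0 := s.2.1
  have h1 : (s : ℝ) < 1 := unitInterval.lt_one_iff_ne_one.2 hs
  have h2 := (sunCoord_mem z).1
  rw [pullToVertex, vertexPull_of_lt h, sunCoord_sunParam]
  · ring
  · constructor <;> nlinarith

theorem vertexDist_pullToVertex_le {z : Lsun 1} (h : vertexDist (sunCoord z) < 1 / 4) (s : I) :
    vertexDist (sunCoord (pullToVertex z s)) ≤ vertexDist (sunCoord z) := by
  have h0 := s.2.1
  have h1 := s.2.2
  have h2 := (sunCoord_mem z).1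
  rcases lt_or_lt_of_vertexDist h with h | h
  · rcases eq_or_ne s 1 with rfl | hs
    · rw [pullToVertex_one ‹_›, sunCoord_sunVertex, vertexDist_one]
      exact le_min h2.le (abs_nonneg _)
    · rw [sunCoord_pullToVertex_of_lt h hs]
      refine le_min ((min_le_left _ _).trans ?_) ((min_le_left _ _).trans ?_)
      · nlinarith
      · rw [abs_sub_comm]
        refine le_trans ?_ (le_abs_self _)
        nlinarith
  · have h3 : vertexDist (sunCoord z) = |sunCoord z - 1| := by
      apply min_eq_right
      rw [abs_le]; constructor <;> linarith
    rw [sunCoord_pullToVertex_of_gt h.1 h.2, h3]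
    refine (min_le_right _ _).trans ?_
    rw [show sunCoord z - s * (sunCoord z - 1) - 1 = (1 - s) * (sunCoord z - 1) by ring, abs_mul,
      abs_of_nonneg (by linarith : (0 : ℝ) ≤ 1 - s)]
    have := abs_nonneg (sunCoord z - 1)
    nlinarith

end SunGraph

section Configurations

open scoped unitInterval Topology

variable {n : ℕ} {X : Type*} [TopologicalSpace X]

/-- Permutations act on ordered configurations by relabelling the points. -/
instance : MulAction (Equiv.Perm (Fin n)) (OrdConf n X) where
  smul τ f := ⟨f.1 ∘ τ.symm, f.2.comp τ.symm.injective⟩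
  one_smul _ := rfl
  mul_smul _ _ _ := rfl

theorem OrdConf.smul_val (τ : Equiv.Perm (Fin n)) (f : OrdConf n X) :
    (τ • f).1 = f.1 ∘ τ.symm := rfl

theorem OrdConf.continuous_val : Continuous (Subtype.val : OrdConf n X → Fin n → X) :=
  continuous_subtype_val

theorem OrdConf.continuous_apply (i : Fin n) : Continuous fun f : OrdConf n X => f.1 i :=
  (_root_.continuous_apply i).comp OrdConf.continuous_val

theorem OrdConf.continuous_iff {Z : Type*} [TopologicalSpace Z] {F : Z → OrdConf n X} :
    Continuous F ↔ ∀ i, Continuous fun z => (F z).1 i :=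
  continuous_induced_rng.trans continuous_pi_iff

theorem confProj_surjective : Function.Surjective (confProj n X) := by
  rintro ⟨s, hs, hn⟩
  have : Finite s := hs
  let e : s ≃ Fin n := Finite.equivFinOfCardEq (by rw [Nat.card_coe_set_eq, hn])
  refine ⟨⟨fun i => e.symm i, Subtype.val_injective.comp e.symm.injective⟩, Subtype.ext ?_⟩
  change range (Subtype.val ∘ e.symm) = s
  rw [e.symm.surjective.range_comp, Subtype.range_coe]

theorem confProj_eq_iff {f g : OrdConf n X} :
    confProj n X f = confProj n X g ↔ f ∈ MulAction.orbit (Equiv.Perm (Fin n)) g := by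
  constructor
  · intro h
    have h' : range f.1 = range g.1 := congrArg Subtype.val h
    let e : Fin n ≃ Fin n := (Equiv.ofInjective f.1 f.2).trans
      ((Equiv.setCongr h').trans (Equiv.ofInjective g.1 g.2).symm)
    refine ⟨e.symm, Subtype.ext (funext fun i => ?_)⟩
    simp only [OrdConf.smul_val, Equiv.symm_symm, Function.comp_apply]
    have := Equiv.apply_ofInjective_symm g.2 (Equiv.setCongr h' (Equiv.ofInjective f.1 f.2 i))
    exact this
  · rintro ⟨τ, rfl⟩
    refine Subtype.ext ?_
    change range (g.1 ∘ τ.symm) = range g.1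
    exact τ.symm.surjective.range_comp _

theorem confProj_congr {f g : OrdConf n X} (τ : Equiv.Perm (Fin n)) (h : f.1 = g.1 ∘ τ) :
    confProj n X f = confProj n X g :=
  confProj_eq_iff.2 ⟨τ.symm, Subtype.ext h.symm⟩

instance : ContinuousConstSMul (Equiv.Perm (Fin n)) (OrdConf n X) where
  continuous_const_smul _ := OrdConf.continuous_iff.2 fun _ => OrdConf.continuous_apply _

theorem isQuotientCoveringMap_confProj [T2Space X] :
    IsQuotientCoveringMap (confProj n X) (Equiv.Perm (Fin n)) where
  toIsQuotientMap := ⟨⟨rfl⟩, confProj_surjective⟩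
  continuous_const_smul := continuous_const_smul
  apply_eq_iff_mem_orbit := confProj_eq_iff
  disjoint f := by
    obtain ⟨U, hU, hd⟩ := (Set.finite_range f.1).t2_separation
    refine ⟨{g | ∀ i, g.1 i ∈ U (f.1 i)}, ?_, ?_⟩
    · refine IsOpen.mem_nhds ?_ fun i => (hU _).1
      simp only [ofPred_forall]
      exact isOpen_iInter_of_finite fun i => (hU _).2.preimage (OrdConf.continuous_apply i)
    · rintro τ ⟨_, ⟨g, hg, rfl⟩, hτ⟩
      ext i : 1
      by_contra hne
      have h1 := hg i
      have h2 : g.1 (τ.symm (τ i)) ∈ U (f.1 (τ i)) := hτ (τ i)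
      rw [Equiv.symm_apply_apply] at h2
      exact Set.disjoint_left.1 (hd ⟨i, rfl⟩ ⟨τ i, rfl⟩ fun h => hne (f.2 h).symm) h1 h2

theorem isOpenQuotientMap_confProj [T2Space X] : IsOpenQuotientMap (confProj n X) :=
  isQuotientCoveringMap_confProj.isOpenQuotientMap

theorem exists_lift_confProj [T2Space X] (γ : C(I, UConf n X)) :
    ∃ f : C(I, OrdConf n X), ∀ s, confProj n X (f s) = γ s := by
  obtain ⟨f₀, hf₀⟩ := confProj_surjective (γ 0)
  obtain ⟨f, hf, -⟩ := isQuotientCoveringMap_confProj.isCoveringMap.exists_path_lifts γ f₀ hf₀.symm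
  exact ⟨f, congr_fun hf⟩

end Configurations

section SortedCoordinates

open scoped unitInterval Topology

variable {n : ℕ}

/-- Increasing tuples of coordinates in `(0, 2]`. -/
abbrev SortedCoord (n : ℕ) : Type :=
  {y : Fin n → ℝ // StrictMono y ∧ ∀ i, y i ∈ Ioc (0 : ℝ) 2}

/-- The ordered configuration on `L₁` with given coordinates. -/
def SortedCoord.toOrd (y : SortedCoord n) : OrdConf n (Lsun 1) :=
  ⟨sunParam ∘ y.1, fun i j h => y.2.1.injective (by
    simpa [sunCoord_sunParam (y.2.2 _)] using congrArg sunCoord h)⟩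

theorem SortedCoord.sunCoord_toOrd (y : SortedCoord n) (i : Fin n) :
    sunCoord (y.toOrd.1 i) = y.1 i := sunCoord_sunParam (y.2.2 i)

theorem SortedCoord.continuous_toOrd : Continuous (SortedCoord.toOrd (n := n)) :=
  OrdConf.continuous_iff.2 fun i =>
    continuous_sunParam.comp ((continuous_apply i).comp continuous_subtype_val)

/-- The configuration on `L₁` with given coordinates. -/
def SortedCoord.toConf (y : SortedCoord n) : UConf n (Lsun 1) := confProj n _ y.toOrd

theorem SortedCoord.continuous_toConf : Continuous (SortedCoord.toConf (n := n)) :=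
  isOpenQuotientMap_confProj.continuous.comp SortedCoord.continuous_toOrd

/-- Relabelling the points of a configuration by a permutation that sorts their coordinates. -/
def sortedOf (f : OrdConf n (Lsun 1)) (τ : Equiv.Perm (Fin n))
    (h : StrictMono ((sunCoord ∘ f.1) ∘ τ)) : SortedCoord n :=
  ⟨(sunCoord ∘ f.1) ∘ τ, h, fun _ => sunCoord_mem _⟩

theorem toConf_sortedOf (f : OrdConf n (Lsun 1)) (τ : Equiv.Perm (Fin n))
    (h : StrictMono ((sunCoord ∘ f.1) ∘ τ)) : (sortedOf f τ h).toConf = confProj n _ f :=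
  confProj_congr τ (funext fun _ => sunParam_sunCoord _)

theorem exists_sorting (f : OrdConf n (Lsun 1)) :
    ∃ τ : Equiv.Perm (Fin n), StrictMono ((sunCoord ∘ f.1) ∘ τ) :=
  ⟨Tuple.sort (sunCoord ∘ f.1), (Tuple.monotone_sort _).strictMono_of_injective
    ((sunCoord_injective.comp f.2).comp (Equiv.injective _))⟩

theorem SortedCoord.toConf_bijective : Function.Bijective (SortedCoord.toConf (n := n)) := by
  constructor
  · intro y z h
    have h1 : range (sunParam ∘ y.1) = range (sunParam ∘ z.1) := congrArg Subtype.val h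
    have h2 : ∀ w : SortedCoord n, sunCoord '' range (sunParam ∘ w.1) = range w.1 := fun w => by
      rw [← range_comp]
      exact congrArg range (funext fun i => w.sunCoord_toOrd i)
    refine Subtype.ext ((y.2.1.range_inj z.2.1).1 ?_)
    rw [← h2, h1, h2]
  · intro x
    obtain ⟨f, rfl⟩ := confProj_surjective x
    obtain ⟨τ, hτ⟩ := exists_sorting f
    exact ⟨_, toConf_sortedOf f τ hτ⟩

/-- The sorted coordinates of a configuration on `L₁`. -/
def confCoord : UConf n (Lsun 1) ≃ SortedCoord n :=
  (Equiv.ofBijective _ SortedCoord.toConf_bijective).symm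

theorem toConf_confCoord (x : UConf n (Lsun 1)) : (confCoord x).toConf = x :=
  (Equiv.ofBijective _ SortedCoord.toConf_bijective).apply_symm_apply x

theorem confCoord_toConf (y : SortedCoord n) : confCoord y.toConf = y :=
  (Equiv.ofBijective _ SortedCoord.toConf_bijective).symm_apply_apply y

theorem confCoord_confProj (f : OrdConf n (Lsun 1)) (τ : Equiv.Perm (Fin n))
    (h : StrictMono ((sunCoord ∘ f.1) ∘ τ)) : confCoord (confProj n _ f) = sortedOf f τ h := by
  rw [← toConf_sortedOf f τ h, confCoord_toConf]

/-- Linear interpolation between sorted tuples. -/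
def SortedCoord.interp (y z : SortedCoord n) (s : I) : SortedCoord n :=
  ⟨fun i => (1 - s) * y.1 i + s * z.1 i, by
    have h0 := s.2.1
    have h1 := s.2.2
    refine ⟨fun i j hij => ?_, fun i => (convex_Ioc (0 : ℝ) 2) (y.2.2 i) (z.2.2 i)
      (sub_nonneg.2 h1) h0 (sub_add_cancel _ _)⟩
    have hy := y.2.1 hij
    have hz := z.2.1 hij
    rcases h0.eq_or_lt with h | h
    · simpa [← h] using hy
    · exact add_lt_add_of_le_of_lt (mul_le_mul_of_nonneg_left hy.le (sub_nonneg.2 h1))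
        (mul_lt_mul_of_pos_left hz h)⟩

theorem SortedCoord.interp_apply (y z : SortedCoord n) (s : I) (i : Fin n) :
    (y.interp z s).1 i = (1 - s) * y.1 i + s * z.1 i := rfl

theorem SortedCoord.interp_zero (y z : SortedCoord n) : y.interp z 0 = y :=
  Subtype.ext (funext fun i => by simp [interp_apply])

theorem SortedCoord.interp_one (y z : SortedCoord n) : y.interp z 1 = z :=
  Subtype.ext (funext fun i => by simp [interp_apply])

theorem SortedCoord.interp_self (y : SortedCoord n) (s : I) : y.interp y s = y :=
  Subtype.ext (funext fun i => by simp only [interp_apply]; ring)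

theorem SortedCoord.continuous_interp {Z : Type*} [TopologicalSpace Z] {F G : Z → SortedCoord n}
    {u : Z → I} (hF : Continuous F) (hG : Continuous G) (hu : Continuous u) :
    Continuous fun z => (F z).interp (G z) (u z) := by
  refine continuous_induced_rng.2 (continuous_pi fun i => ?_)
  have h1 : Continuous fun z => (F z).1 i :=
    (continuous_apply i).comp (continuous_subtype_val.comp hF)
  have h2 : Continuous fun z => (G z).1 i :=
    (continuous_apply i).comp (continuous_subtype_val.comp hG)
  exact ((continuous_const.sub (continuous_subtype_val.comp hu)).mul h1).add
    ((continuous_subtype_val.comp hu).mul h2)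

/-- The path between two configurations given by linear interpolation of sorted coordinates. -/
def linearPath (x y : UConf n (Lsun 1)) : Path x y where
  toFun s := ((confCoord x).interp (confCoord y) s).toConf
  continuous_toFun := SortedCoord.continuous_toConf.comp
    (SortedCoord.continuous_interp continuous_const continuous_const continuous_id)
  source' := by rw [SortedCoord.interp_zero, toConf_confCoord]
  target' := by rw [SortedCoord.interp_one, toConf_confCoord]

theorem homotopic_of_sortedLift {x y : UConf n (Lsun 1)} {γ δ : Path x y}
    {Y Z : I → SortedCoord n} (hY : Continuous Y) (hZ : Continuous Z)
    (hγ : ∀ s, γ s = (Y s).toConf) (hδ : ∀ s, δ s = (Z s).toConf) : γ.Homotopic δ := by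
  have h0 : Y 0 = Z 0 := SortedCoord.toConf_bijective.1 (by rw [← hγ, ← hδ, γ.source, δ.source])
  have h1 : Y 1 = Z 1 := SortedCoord.toConf_bijective.1 (by rw [← hγ, ← hδ, γ.target, δ.target])
  exact ⟨{
    toFun := fun p => ((Y p.2).interp (Z p.2) p.1).toConf
    continuous_toFun := SortedCoord.continuous_toConf.comp
      (SortedCoord.continuous_interp
        (hY.comp continuous_snd) (hZ.comp continuous_snd) continuous_fst)
    map_zero_left := fun s => by simp [SortedCoord.interp_zero, hγ]
    map_one_left := fun s => by simp [SortedCoord.interp_one, hδ]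
    prop' := by
      rintro u s (rfl | rfl)
      · simp [h0, SortedCoord.interp_self, hγ, -Path.source]
      · simp [h1, SortedCoord.interp_self, hγ, -Path.target] }⟩

/-- The loop at `x₀` obtained by joining the endpoints of `γ` to `x₀` linearly. -/
abbrev confLoop (x₀ : UConf n (Lsun 1)) (γ : C(I, UConf n (Lsun 1))) :
    FundamentalGroup (UConf n (Lsun 1)) x₀ :=
  basedLoop (linearPath x₀) γ

theorem confLoop_of_sortedLift (x₀ : UConf n (Lsun 1)) {γ : C(I, UConf n (Lsun 1))}
    {Y : I → SortedCoord n} (hY : Continuous Y) (hγ : ∀ s, γ s = (Y s).toConf) :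
    confLoop x₀ γ = 1 := by
  have hY0 : Y 0 = confCoord (γ 0) := by rw [hγ, confCoord_toConf]
  let P : Path (confCoord x₀) (confCoord (γ 0)) :=
    ⟨⟨fun s => (confCoord x₀).interp (confCoord (γ 0)) s,
      SortedCoord.continuous_interp continuous_const continuous_const continuous_id⟩,
      SortedCoord.interp_zero _ _, SortedCoord.interp_one _ _⟩
  let Q : Path (confCoord (γ 0)) (Y 1) := ⟨⟨Y, hY⟩, hY0, rfl⟩
  have key : ((linearPath x₀ (γ 0)).trans ⟨γ, rfl, rfl⟩).Homotopic (linearPath x₀ (γ 1)) := by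
    refine homotopic_of_sortedLift (P.trans Q).continuous
      (SortedCoord.continuous_interp continuous_const continuous_const continuous_id)
      (fun s => ?_) fun s => rfl
    rw [Path.trans_apply, Path.trans_apply]
    split_ifs
    · rfl
    · exact hγ _
  have := Path.Homotopic.Quotient.eq.2 key
  rw [Path.Homotopic.Quotient.mk_trans] at this
  rw [confLoop, basedLoop, this, Path.Homotopic.Quotient.trans_symm]
  rfl

theorem confLoop_loop {x₀ : UConf n (Lsun 1)} (γ : Path x₀ x₀) :
    confLoop x₀ γ.toContinuousMap = FundamentalGroup.fromPath (.mk γ) := by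
  refine basedLoop_loop _ (homotopic_of_sortedLift (Z := fun _ => confCoord x₀)
      (SortedCoord.continuous_interp continuous_const continuous_const continuous_id)
      continuous_const (fun s => rfl) fun s => ?_) γ
  rw [toConf_confCoord, Path.refl_apply]

/-- A path of configurations along which all coordinates vary continuously is trivial. -/
theorem confLoop_of_continuous_sunCoord (x₀ : UConf n (Lsun 1)) (f : C(I, OrdConf n (Lsun 1)))
    (hf : ∀ i, Continuous fun s => sunCoord ((f s).1 i)) {γ : C(I, UConf n (Lsun 1))}
    (hγ : ∀ s, γ s = confProj n _ (f s)) : confLoop x₀ γ = 1 := by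
  obtain ⟨τ, hτ⟩ := exists_sorting (f 0)
  have hs : ∀ s, StrictMono ((sunCoord ∘ (f s).1) ∘ τ) := by
    intro s i j hij
    by_contra! hle
    have h0 : (0 : ℝ) ∈ range fun u : I =>
        sunCoord ((f u).1 (τ j)) - sunCoord ((f u).1 (τ i)) :=
      mem_range_of_exists_le_of_exists_ge ((hf _).sub (hf _)) ⟨s, sub_nonpos.2 hle⟩
        ⟨0, sub_nonneg.2 (hτ hij).le⟩
    obtain ⟨u, hu⟩ := h0
    exact hij.ne' (τ.injective ((f u).2 (sunCoord_injective (sub_eq_zero.1 hu))))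
  refine confLoop_of_sortedLift x₀ (Y := fun s => sortedOf (f s) τ (hs s))
    (continuous_induced_rng.2 (continuous_pi fun i => hf _)) fun s => ?_
  rw [hγ, toConf_sortedOf]

end SortedCoordinates

section Retraction

open scoped unitInterval Topology

variable {n : ℕ}

theorem vertexDist_sunCoord_nonneg (z : Lsun 1) : 0 ≤ vertexDist (sunCoord z) :=
  le_min (sunCoord_mem z).1.le (abs_nonneg _)

theorem vertexDist_of_lt {t : ℝ} (h : t < 1 / 4) : vertexDist t = t := by
  refine min_eq_left ?_
  rw [abs_sub_comm]
  exact le_trans (by linarith) (le_abs_self _)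

/-- The ordered configurations whose `i`-th point is close to the vertex and closer to it than all
the other points. -/
def nearSet (i : Fin n) : Set (OrdConf n (Lsun 1)) :=
  {f | vertexDist (sunCoord (f.1 i)) < 1 / 4 ∧
    ∀ j ≠ i, vertexDist (sunCoord (f.1 i)) < vertexDist (sunCoord (f.1 j))}

/-- The ordered configurations avoiding the vertex. -/
def avoidSet (n : ℕ) : Set (OrdConf n (Lsun 1)) := {f | ∀ i, f.1 i ≠ sunVertex}

theorem isOpen_nearSet (i : Fin n) : IsOpen (nearSet i) := by
  have h (j : Fin n) : Continuous fun f : OrdConf n (Lsun 1) => vertexDist (sunCoord (f.1 j)) :=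
    continuous_vertexDist_sunCoord.comp (OrdConf.continuous_apply j)
  refine (isOpen_lt (h i) continuous_const).inter (?_ : IsOpen {f | ∀ j ≠ i, _})
  simp only [ofPred_forall]
  exact isOpen_iInter_of_finite fun j => isOpen_iInter_of_finite fun _ => isOpen_lt (h i) (h j)

theorem isOpen_avoidSet : IsOpen (avoidSet n) := by
  simp only [avoidSet, ofPred_forall]
  exact isOpen_iInter_of_finite fun i =>
    isOpen_ne.preimage (OrdConf.continuous_apply i)

theorem mem_nearSet_of_eq_sunVertex {f : OrdConf n (Lsun 1)} {i : Fin n}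
    (h : f.1 i = sunVertex) : f ∈ nearSet i := by
  have h0 : vertexDist (sunCoord (f.1 i)) = 0 := by rw [h, sunCoord_sunVertex, vertexDist_one]
  refine ⟨by rw [h0]; norm_num, fun j hj => ?_⟩
  rw [h0]
  exact vertexDist_pos (sunCoord_mem _).1 fun h1 => hj (f.2 ((sunCoord_eq_one.1 h1).trans h.symm))

theorem ne_sunVertex_of_mem_nearSet {f : OrdConf n (Lsun 1)} {i j : Fin n} (hf : f ∈ nearSet i)
    (hj : j ≠ i) : f.1 j ≠ sunVertex := fun h => by
  have := hf.2 j hj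
  rw [h, sunCoord_sunVertex, vertexDist_one] at this
  exact absurd this (vertexDist_sunCoord_nonneg _).not_gt

/-- Pulling the point nearest to the vertex towards the vertex. -/
def pullConf {i : Fin n} (f : nearSet i) (u : I) : OrdConf n (Lsun 1) :=
  ⟨Function.update f.1.1 i (pullToVertex (f.1.1 i) u), by
    have key (b : Fin n) (hb : b ≠ i) : pullToVertex (f.1.1 i) u ≠ f.1.1 b := fun h => by
      have := vertexDist_pullToVertex_le f.2.1 u
      rw [h] at this
      exact absurd (f.2.2 b hb) this.not_gt
    intro a b hab
    by_cases ha : a = i <;> by_cases hb : b = i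
    · rw [ha, hb]
    · subst ha
      rw [Function.update_self, Function.update_of_ne hb] at hab
      exact absurd hab (key b hb)
    · subst hb
      rw [Function.update_self, Function.update_of_ne ha] at hab
      exact absurd hab.symm (key a ha)
    · rw [Function.update_of_ne hb, Function.update_of_ne ha] at hab
      exact f.1.2 hab⟩

theorem pullConf_self {i : Fin n} (f : nearSet i) (u : I) :
    (pullConf f u).1 i = pullToVertex (f.1.1 i) u := Function.update_self ..

theorem pullConf_of_ne {i j : Fin n} (f : nearSet i) (u : I) (h : j ≠ i) :
    (pullConf f u).1 j = f.1.1 j := Function.update_of_ne h ..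

theorem pullConf_zero {i : Fin n} (f : nearSet i) : pullConf f 0 = f.1 :=
  Subtype.ext (by simp [pullConf, pullToVertex_zero])

attribute [irreducible] pullConf pullToVertex

theorem continuous_pullConf (i : Fin n) : Continuous fun p : nearSet i × I => pullConf p.1 p.2 := by
  have h (j : Fin n) : Continuous fun p : nearSet i × I => p.1.1.1 j :=
    (OrdConf.continuous_apply j).comp (continuous_subtype_val.comp continuous_fst)
  refine OrdConf.continuous_iff.2 fun j => ?_
  by_cases hj : j = i
  · subst hj
    simp only [pullConf_self]
    have h' : Continuous fun p : nearSet j × I => (p.1.1.1 j, p.2) := (h j).prodMk continuous_snd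
    exact continuous_pullToVertex.comp h'
  · simp only [pullConf_of_ne _ _ hj]
    exact h j

/-- The path of configurations pulling the nearest point into the vertex. -/
def pullPath {i : Fin n} (f : nearSet i) : C(I, UConf n (Lsun 1)) :=
  ⟨fun u => confProj n _ (pullConf f u), isOpenQuotientMap_confProj.continuous.comp
    ((continuous_pullConf i).comp (continuous_const.prodMk continuous_id))⟩

/-- Along a path of configurations for which the `i`-th point stays nearest to the vertex, the loop
is determined by pulling this point into the vertex at both ends. -/
theorem confLoop_pullPath_mul (x₀ : UConf n (Lsun 1)) {i : Fin n} (F : C(I, nearSet i))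
    {γ : C(I, UConf n (Lsun 1))} (hγ : ∀ s, γ s = confProj n _ (F s).1) :
    confLoop x₀ (pullPath (F 1)) * confLoop x₀ γ = confLoop x₀ (pullPath (F 0)) := by
  let H₀ : C(I × I, OrdConf n (Lsun 1)) :=
    ⟨fun p => pullConf (F p.1) p.2, (continuous_pullConf i).comp
      ((F.continuous.comp continuous_fst).prodMk continuous_snd)⟩
  let H : C(I × I, UConf n (Lsun 1)) :=
    ⟨fun p => confProj n _ (H₀ p), isOpenQuotientMap_confProj.continuous.comp H₀.continuous⟩
  have h := basedLoop_square (linearPath x₀) H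
  have h1 : basedLoop (linearPath x₀) (H.comp (.prodMk (.id I) (.const I 1))) = 1 := by
    refine confLoop_of_continuous_sunCoord x₀ (H₀.comp (.prodMk (.id I) (.const I 1)))
      (fun j => ?_) fun s => rfl
    by_cases hj : j = i
    · subst hj
      have (s : I) : (pullConf (F s) 1).1 j = sunVertex := by
        rw [pullConf_self, pullToVertex_one (F s).2.1]
      change Continuous fun s : I => sunCoord ((pullConf (F s) 1).1 j)
      simp only [this]
      exact continuous_const
    · change Continuous fun s : I => sunCoord ((pullConf (F s) 1).1 j)
      simp only [pullConf_of_ne _ _ hj]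
      refine continuous_iff_continuousAt.2 fun s => ContinuousAt.comp (g := sunCoord)
        (continuousAt_sunCoord (ne_sunVertex_of_mem_nearSet (F s).2 hj)) ?_
      exact ((OrdConf.continuous_apply j).comp
        (continuous_subtype_val.comp F.continuous)).continuousAt
  rw [h1, one_mul] at h
  have h2 : H.comp (.prodMk (.id I) (.const I 0)) = γ := by
    ext1 s
    rw [hγ, ← pullConf_zero]
    rfl
  rw [h2] at h
  exact h

theorem confLoop_pullPath_eq_one (x₀ : UConf n (Lsun 1)) {i : Fin n} (f : nearSet i)
    (h : 1 / 4 ≤ sunCoord (f.1.1 i)) : confLoop x₀ (pullPath f) = 1 := by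
  obtain h' | h' := lt_or_lt_of_vertexDist f.2.1
  · exact absurd h h'.not_ge
  refine confLoop_of_continuous_sunCoord x₀
    ⟨fun u => pullConf f u, (continuous_pullConf i).comp (continuous_const.prodMk continuous_id)⟩
    (fun j => ?_) fun s => rfl
  by_cases hj : j = i
  · subst hj
    simp only [ContinuousMap.coe_mk, pullConf_self, sunCoord_pullToVertex_of_gt h'.1 h'.2]
    fun_prop
  · simp only [ContinuousMap.coe_mk, pullConf_of_ne _ _ hj]
    exact continuous_const

end Retraction

section Generators

open scoped unitInterval Topology

variable {n : ℕ} [NeZero n]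

/-- The sorted tuples whose first point lies near the end `0` of the loop, is the point nearest to
the vertex, and for which exactly the points up to the `k`-th one lie on the circle. -/
def startSet (k : Fin n) : Set (SortedCoord n) :=
  {y | y.1 0 < 1 / 4 ∧
    ∀ j ≠ 0, (j ≤ k → y.1 0 + y.1 j < 1) ∧ (k < j → y.1 0 + 1 < y.1 j)}

theorem lt_one_iff_of_mem_startSet {k : Fin n} {y : SortedCoord n} (hy : y ∈ startSet k)
    (j : Fin n) : y.1 j < 1 ↔ j ≤ k := by
  have h0 := (y.2.2 0).1
  by_cases hj : j = 0
  · subst hj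
    exact iff_of_true (hy.1.trans (by norm_num)) (Fin.zero_le _)
  · refine ⟨fun h => ?_, fun h => ?_⟩
    · by_contra! hk
      linarith [(hy.2 j hj).2 hk]
    · linarith [(hy.2 j hj).1 h]

theorem startSet_unique {k l : Fin n} {y : SortedCoord n} (hk : y ∈ startSet k)
    (hl : y ∈ startSet l) : k = l :=
  le_antisymm ((lt_one_iff_of_mem_startSet hl k).1 ((lt_one_iff_of_mem_startSet hk k).2 le_rfl))
    ((lt_one_iff_of_mem_startSet hk l).1 ((lt_one_iff_of_mem_startSet hl l).2 le_rfl))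

theorem interp_mem_startSet {k : Fin n} {y z : SortedCoord n} (hy : y ∈ startSet k)
    (hz : z ∈ startSet k) (s : I) : y.interp z s ∈ startSet k := by
  have h0 := s.2.1
  have h1 := sub_nonneg.2 s.2.2
  have key {a b c : ℝ} (ha : a < c) (hb : b < c) : (1 - s) * a + s * b < c :=
    convex_Iio c ha hb h1 h0 (sub_add_cancel _ _)
  refine ⟨key hy.1 hz.1, fun j hj => ⟨fun h => ?_, fun h => ?_⟩⟩
  · have := key ((hy.2 j hj).1 h) ((hz.2 j hj).1 h)
    simp only [SortedCoord.interp_apply]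
    linarith
  · have := key (sub_neg.2 ((hy.2 j hj).2 h)) (sub_neg.2 ((hz.2 j hj).2 h))
    simp only [SortedCoord.interp_apply]
    linarith

theorem toOrd_mem_nearSet {k : Fin n} {y : SortedCoord n} (hy : y ∈ startSet k) :
    y.toOrd ∈ nearSet 0 := by
  simp only [nearSet, mem_ofPred_eq, y.sunCoord_toOrd, vertexDist_of_lt hy.1]
  refine ⟨hy.1, fun j hj => lt_min (y.2.1 (Fin.pos_iff_ne_zero.2 hj)) ?_⟩
  rcases le_or_gt j k with h | h
  · rw [abs_sub_comm]
    exact lt_of_lt_of_le (by linarith [(hy.2 j hj).1 h]) (le_abs_self _)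
  · exact lt_of_lt_of_le (by linarith [(hy.2 j hj).2 h]) (le_abs_self _)

theorem exists_mem_startSet {y : SortedCoord n} (h0 : y.1 0 < 1 / 4)
    (h : ∀ j ≠ 0, y.1 0 < vertexDist (y.1 j)) : ∃ k, y ∈ startSet k := by
  have hne : (Finset.univ.filter fun j => y.1 j < 1).Nonempty :=
    ⟨0, by simp only [Finset.mem_filter_univ]; linarith⟩
  refine ⟨Finset.max' _ hne, h0, fun j hj => ⟨fun hjk => ?_, fun hjk => ?_⟩⟩
  · have h1 := Finset.max'_mem _ hne
    rw [Finset.mem_filter_univ] at h1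
    have h2 := (y.2.1.monotone hjk).trans_lt h1
    have h3 := (h j hj).trans_le (min_le_right _ _)
    rw [abs_of_neg (by linarith)] at h3
    linarith
  · have h1 : 1 ≤ y.1 j := by
      by_contra! hlt
      exact absurd (Finset.le_max' _ j (by simpa using hlt)) hjk.not_ge
    have h3 := (h j hj).trans_le (min_le_right _ _)
    rw [abs_of_nonneg (by linarith)] at h3
    linarith

/-- A tuple in `startSet k`. -/
def startCoord (k : Fin n) : SortedCoord n :=
  ⟨fun j => ((j : ℕ) + 1) / (8 * n) + if j ≤ k then 0 else 3 / 2, by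
    have hn : (0 : ℝ) < n := Nat.cast_pos.2 (NeZero.pos n)
    refine ⟨fun i j hij => add_lt_add_of_lt_of_le ?_ ?_, fun i => ?_⟩
    · gcongr
      exact hij
    · split_ifs with h1 h2
      · rfl
      · norm_num
      · exact absurd (hij.le.trans ‹j ≤ k›) h1
      · rfl
    · have h1 : (0 : ℝ) < ((i : ℕ) + 1) / (8 * n) := by positivity
      have h2 : ((i : ℕ) + 1 : ℝ) / (8 * n) ≤ 1 / 8 := by
        rw [div_le_iff₀ (by positivity)]
        have : ((i : ℕ) + 1 : ℝ) ≤ n := by exact_mod_cast i.2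
        linarith
      beta_reduce
      split_ifs <;> constructor <;> linarith⟩

theorem startCoord_mem (k : Fin n) : startCoord k ∈ startSet k := by
  have hn : (0 : ℝ) < n := Nat.cast_pos.2 (NeZero.pos n)
  have hb (i : Fin n) : (0 : ℝ) < ((i : ℕ) + 1) / (8 * n) ∧
      ((i : ℕ) + 1 : ℝ) / (8 * n) ≤ 1 / 8 := by
    refine ⟨by positivity, ?_⟩
    rw [div_le_iff₀ (by positivity)]
    have : ((i : ℕ) + 1 : ℝ) ≤ n := by exact_mod_cast i.2
    linarith
  have h0 : (startCoord k).1 0 ≤ 1 / 8 := by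
    simpa only [startCoord, if_pos (Fin.zero_le k), add_zero] using (hb 0).2
  refine ⟨h0.trans_lt (by norm_num), fun j _ => ⟨fun h => ?_, fun h => ?_⟩⟩
  · have : (startCoord k).1 j ≤ 1 / 8 := by
      simpa only [startCoord, if_pos h, add_zero] using (hb j).2
    linarith
  · have : 3 / 2 < (startCoord k).1 j := by
      simp only [startCoord, if_neg h.not_ge]
      linarith [(hb j).1]
    linarith

/-- The loop that pulls the first point of a configuration in `startSet k` through the end `0` of
the loop into the vertex. -/
def braidGen (x₀ : UConf n (Lsun 1)) (k : Fin n) : FundamentalGroup (UConf n (Lsun 1)) x₀ :=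
  confLoop x₀ (pullPath ⟨_, toOrd_mem_nearSet (startCoord_mem k)⟩)

theorem confLoop_pullPath_toOrd (x₀ : UConf n (Lsun 1)) {k : Fin n} {y : SortedCoord n}
    (hy : y ∈ startSet k) : confLoop x₀ (pullPath ⟨_, toOrd_mem_nearSet hy⟩) = braidGen x₀ k := by
  have hY : Continuous fun s : I => (startCoord k).interp y s :=
    SortedCoord.continuous_interp continuous_const continuous_const continuous_id
  let F : C(I, nearSet (0 : Fin n)) :=
    ⟨fun s => ⟨_, toOrd_mem_nearSet (interp_mem_startSet (startCoord_mem k) hy s)⟩,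
      (SortedCoord.continuous_toOrd.comp hY).subtype_mk _⟩
  let γ : C(I, UConf n (Lsun 1)) :=
    ⟨fun s => ((startCoord k).interp y s).toConf, SortedCoord.continuous_toConf.comp hY⟩
  have h := confLoop_pullPath_mul x₀ F (γ := γ) fun s => rfl
  rw [confLoop_of_sortedLift x₀ (γ := γ) hY fun s => rfl, mul_one] at h
  have h0 : F 0 = ⟨_, toOrd_mem_nearSet (startCoord_mem k)⟩ :=
    Subtype.ext (congrArg SortedCoord.toOrd (SortedCoord.interp_zero _ _))
  have h1 : F 1 = ⟨_, toOrd_mem_nearSet hy⟩ :=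
    Subtype.ext (congrArg SortedCoord.toOrd (SortedCoord.interp_one _ _))
  rwa [h0, h1] at h

theorem symm_apply_eq_zero {i : Fin n} {f : OrdConf n (Lsun 1)} (hf : f ∈ nearSet i)
    (h : sunCoord (f.1 i) < 1 / 4) {τ : Equiv.Perm (Fin n)}
    (hτ : StrictMono ((sunCoord ∘ f.1) ∘ τ)) : τ 0 = i := by
  by_contra hne
  have h1 := hf.2 _ hne
  rw [vertexDist_of_lt h] at h1
  have h2 : 0 < τ.symm i := Fin.pos_iff_ne_zero.2 fun h0 => hne (by rw [← h0, τ.apply_symm_apply])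
  have h3 := hτ h2
  simp only [Function.comp_apply, τ.apply_symm_apply] at h3
  exact absurd (h1.trans_le (min_le_left _ _)) h3.not_gt

theorem exists_sortedOf_mem_startSet {i : Fin n} {f : OrdConf n (Lsun 1)} (hf : f ∈ nearSet i)
    (h : sunCoord (f.1 i) < 1 / 4) {τ : Equiv.Perm (Fin n)}
    (hτ : StrictMono ((sunCoord ∘ f.1) ∘ τ)) : ∃ k, sortedOf f τ hτ ∈ startSet k := by
  have h0 := symm_apply_eq_zero hf h hτ
  have h1 : (sortedOf f τ hτ).1 0 = sunCoord (f.1 i) := by simp [sortedOf, h0]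
  refine exists_mem_startSet (h1 ▸ h) fun j hj => ?_
  rw [h1, ← vertexDist_of_lt h]
  exact hf.2 (τ j) fun hj' => hj (τ.injective (hj'.trans h0.symm))

theorem confLoop_pullPath_mem (x₀ : UConf n (Lsun 1)) {i : Fin n} (f : nearSet i) :
    confLoop x₀ (pullPath f) ∈ (FreeGroup.lift (braidGen x₀)).range := by
  rcases le_or_gt (1 / 4) (sunCoord (f.1.1 i)) with h | h
  · rw [confLoop_pullPath_eq_one x₀ f h]
    exact one_mem _
  obtain ⟨τ, hτ⟩ := exists_sorting f.1
  obtain ⟨k, hk⟩ := exists_sortedOf_mem_startSet f.2 h hτ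
  have h0 := symm_apply_eq_zero f.2 h hτ
  have hp : pullPath f = pullPath ⟨_, toOrd_mem_nearSet hk⟩ := by
    ext1 u
    refine (confProj_congr τ (funext fun j => ?_)).symm
    have hv (j : Fin n) : (sortedOf f.1 τ hτ).toOrd.1 j = f.1.1 (τ j) := sunParam_sunCoord _
    by_cases hj : j = 0
    · subst hj
      rw [pullConf_self, hv, h0, Function.comp_apply, h0, pullConf_self]
    · rw [pullConf_of_ne _ _ hj, hv, Function.comp_apply,
        pullConf_of_ne _ _ fun hj' => hj (τ.injective (hj'.trans h0.symm))]
  rw [hp, confLoop_pullPath_toOrd x₀ hk]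
  exact ⟨FreeGroup.of k, FreeGroup.lift_apply_of⟩

theorem confLoop_mem_of_lift (x₀ : UConf n (Lsun 1)) (F : C(I, OrdConf n (Lsun 1)))
    {γ : C(I, UConf n (Lsun 1))} (hγ : ∀ s, γ s = confProj n _ (F s))
    (h : (∀ s, F s ∈ avoidSet n) ∨ ∃ i, ∀ s, F s ∈ nearSet i) :
    confLoop x₀ γ ∈ (FreeGroup.lift (braidGen x₀)).range := by
  obtain h | ⟨i, h⟩ := h
  · rw [confLoop_of_continuous_sunCoord x₀ F (fun i => ?_) hγ]
    · exact one_mem _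
    · exact continuous_iff_continuousAt.2 fun s => ContinuousAt.comp (g := sunCoord)
        (continuousAt_sunCoord (h s i))
        ((OrdConf.continuous_apply i).comp F.continuous).continuousAt
  · have h' := confLoop_pullPath_mul x₀ ⟨fun s => ⟨F s, h s⟩, F.continuous.subtype_mk _⟩ hγ
    rw [eq_inv_mul_of_mul_eq h']
    exact mul_mem (inv_mem (confLoop_pullPath_mem x₀ _)) (confLoop_pullPath_mem x₀ _)

theorem lift_braidGen_surjective (x₀ : UConf n (Lsun 1)) :
    Function.Surjective (FreeGroup.lift (braidGen x₀)) := by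
  intro g
  obtain ⟨γ, rfl⟩ : ∃ γ : Path x₀ x₀, FundamentalGroup.fromPath (.mk γ) = g :=
    Path.Homotopic.Quotient.mk_surjective g
  rw [← confLoop_loop, ← MonoidHom.mem_range]
  obtain ⟨f, hf⟩ := exists_lift_confProj γ.toContinuousMap
  let c : Option (Fin n) → Set (OrdConf n (Lsun 1)) := fun i => i.elim (avoidSet n) nearSet
  refine basedLoop_mem_of_cover _ (c := fun i => f ⁻¹' c i) (fun i => ?_) (fun s _ => ?_) _ _
    fun i a b hi hab => ?_
  · cases i with
    | none => exact isOpen_avoidSet.preimage f.continuous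
    | some i => exact (isOpen_nearSet i).preimage f.continuous
  · by_cases hs : f s ∈ avoidSet n
    · exact mem_iUnion.2 ⟨none, hs⟩
    · obtain ⟨i, hi⟩ : ∃ i, (f s).1 i = sunVertex := by simpa [avoidSet] using hs
      exact mem_iUnion.2 ⟨some i, mem_nearSet_of_eq_sunVertex hi⟩
  · have hab' (s : I) : Icc.convexComb a b s ∈ Icc a b := by
      rw [← uIcc_of_le hab, ← Path.range_subpathAux]
      exact mem_range_self s
    refine confLoop_mem_of_lift x₀ (pathPiece f a b) (fun s => (hf _).symm) ?_
    cases i with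
    | none => exact .inl fun s => hi (hab' s)
    | some i => exact .inr ⟨i, fun s => hi (hab' s)⟩

end Generators

section Transport

open scoped unitInterval Topology

/-- A covering of a space by two open sets together with a locally constant cocycle on their
intersection, extended by `1` outside of the first set. -/
structure TwoChartCocycle (X G : Type*) [TopologicalSpace X] [TopologicalSpace G] [Group G] where
  /-- The two open sets. -/
  chart : Bool → Set X
  isOpen_chart : ∀ i, IsOpen (chart i)
  cover : ∀ x ∉ chart true, x ∈ chart false
  /-- The transition function. -/
  trans : X → G
  continuousOn_trans : ContinuousOn trans (chart true ∩ chart false)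
  trans_eq_one : ∀ x ∉ chart true, trans x = 1

namespace TwoChartCocycle

variable {X G : Type*} [TopologicalSpace X] [TopologicalSpace G] [DiscreteTopology G] [Group G]
  (c : TwoChartCocycle X G)

/-- The change from the first chart to the given one. -/
def change (i : Bool) (x : X) : G := if i then 1 else c.trans x

theorem continuousOn_change_mul_inv (i j : Bool) :
    ContinuousOn (fun x => c.change j x * (c.change i x)⁻¹) (c.chart i ∩ c.chart j) := by
  cases i <;> cases j
  · simpa using continuousOn_const
  · simpa [change, inter_comm, Function.comp_def] using
      (continuous_of_discreteTopology (f := fun g : G => g⁻¹)).comp_continuousOn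
        c.continuousOn_trans
  · simpa [change] using c.continuousOn_trans
  · simpa using continuousOn_const

open Classical in
/-- The principal bundle associated to a cocycle. -/
def core : FiberBundleCore Bool X G where
  baseSet := c.chart
  isOpen_baseSet := c.isOpen_chart
  indexAt x := decide (x ∈ c.chart true)
  mem_baseSet_at x := by
    by_cases h : x ∈ c.chart true
    · simp [h]
    · simpa [h] using c.cover x h
  coordChange i j x g := c.change j x * (c.change i x)⁻¹ * g
  coordChange_self i x _ g := by simp
  continuousOn_coordChange i j :=
    (continuous_of_discreteTopology (f := fun q : G × G => q.1 * q.2)).comp_continuousOn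
      (((c.continuousOn_change_mul_inv i j).comp continuousOn_fst fun p hp => hp.1).prodMk
        continuousOn_snd)
  coordChange_comp i j k x _ g := by group

theorem change_indexAt (x : X) : c.change (c.core.indexAt x) x = 1 := by
  by_cases h : x ∈ c.chart true
  · simp [core, change, h]
  · simp [core, change, h, c.trans_eq_one x h]

theorem isCoveringMap_proj : IsCoveringMap c.core.proj :=
  FiberBundle.isCoveringMap (F := G) (E := c.core.Fiber)

theorem continuous_mk {Z : Type*} [TopologicalSpace Z] {f : Z → X} (hf : Continuous f) {e : Z → G}
    (he : ∀ i, ContinuousOn (fun z => c.change i (f z) * e z) (f ⁻¹' c.chart i)) :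
    Continuous fun z => (⟨f z, e z⟩ : c.core.TotalSpace) := by
  refine continuous_iff_continuousAt.2 fun z => ?_
  have hz := c.core.mem_baseSet_at (f z)
  set i := c.core.indexAt (f z)
  refine (c.core.localTriv i).continuousAt_of_comp_left hf.continuousAt hz ?_
  have h : (c.core.localTriv i ∘ fun z => (⟨f z, e z⟩ : c.core.TotalSpace)) =
      fun z => (f z, c.change i (f z) * e z) := by
    funext w
    refine Prod.ext rfl ?_
    change c.change i (f w) * (c.change (c.core.indexAt (f w)) (f w))⁻¹ * e w = _
    rw [c.change_indexAt, inv_one, mul_one]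
  rw [h]
  exact hf.continuousAt.prodMk
    ((he i).continuousAt (((c.isOpen_chart i).preimage hf).mem_nhds hz))

/-- Parallel transport along a homotopy class of paths. -/
def transport {x y : X} (p : Path.Homotopic.Quotient x y) (g : G) : G :=
  (c.isCoveringMap_proj.monodromy p ⟨⟨x, g⟩, rfl⟩).1.2

theorem transport_trans {x y z : X} (p : Path.Homotopic.Quotient x y)
    (q : Path.Homotopic.Quotient y z) (g : G) :
    c.transport (p.trans q) g = c.transport q (c.transport p g) := by
  rw [transport, c.isCoveringMap_proj.monodromy_trans_apply]
  have h : c.isCoveringMap_proj.monodromy p ⟨⟨x, g⟩, rfl⟩ = ⟨⟨y, c.transport p g⟩, rfl⟩ := by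
    unfold transport
    obtain ⟨⟨y', g'⟩, h⟩ := c.isCoveringMap_proj.monodromy p ⟨⟨x, g⟩, rfl⟩
    obtain rfl : y' = y := h
    rfl
  rw [h]
  rfl

theorem transport_refl (x : X) (g : G) : c.transport (.refl x) g = g := by
  rw [transport, c.isCoveringMap_proj.monodromy_refl, id]

theorem transport_mk {x y : X} (γ : Path x y) (e : I → G)
    (he : ∀ i, ContinuousOn (fun s => c.change i (γ s) * e s) (γ ⁻¹' c.chart i)) :
    c.transport (.mk γ) (e 0) = e 1 := by
  obtain ⟨γ, rfl, rfl⟩ := γ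
  let Γ : Path (⟨γ 0, e 0⟩ : c.core.TotalSpace) ⟨γ 1, e 1⟩ :=
    ⟨⟨fun s => ⟨γ s, e s⟩, c.continuous_mk γ.continuous he⟩, rfl, rfl⟩
  have h := c.isCoveringMap_proj.monodromy_map (.mk Γ)
  exact congrArg (fun z : c.core.proj ⁻¹' {γ 1} => z.1.2) h

theorem transport_symm {x y : X} {p : Path.Homotopic.Quotient x y} {g h : G}
    (hp : c.transport p g = h) : c.transport p.symm h = g := by
  rw [← hp, ← transport_trans, Path.Homotopic.Quotient.trans_symm, transport_refl]

end TwoChartCocycle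

end Transport

section Cocycle

open scoped unitInterval Topology

variable {n : ℕ}

/-- The configurations on `L₁` some point of which is close to the vertex and closer to it than all
the other points. -/
def nearConf (n : ℕ) : Set (UConf n (Lsun 1)) := ⋃ i, confProj n _ '' nearSet i

/-- The configurations on `L₁` avoiding the vertex. -/
def avoidConf (n : ℕ) : Set (UConf n (Lsun 1)) := {x | sunVertex ∉ x.1}

theorem confProj_mem_avoidConf {f : OrdConf n (Lsun 1)} :
    confProj n _ f ∈ avoidConf n ↔ f ∈ avoidSet n :=
  not_exists

theorem isOpen_nearConf : IsOpen (nearConf n) :=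
  isOpen_iUnion fun i => isOpenQuotientMap_confProj.isOpenMap _ (isOpen_nearSet i)

theorem isOpen_avoidConf : IsOpen (avoidConf n) := by
  refine isOpenQuotientMap_confProj.isQuotientMap.isOpen_preimage.1 ?_
  convert isOpen_avoidSet (n := n)
  ext f
  exact confProj_mem_avoidConf

theorem mem_nearConf_of_notMem {x : UConf n (Lsun 1)} (hx : x ∉ avoidConf n) :
    x ∈ nearConf n := by
  obtain ⟨f, rfl⟩ := confProj_surjective x
  obtain ⟨i, hi⟩ : ∃ i, f.1 i = sunVertex := not_not.1 hx
  exact mem_iUnion.2 ⟨i, f, mem_nearSet_of_eq_sunVertex hi, rfl⟩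

theorem exists_toOrd_mem_nearSet {x : UConf n (Lsun 1)} (hx : x ∈ nearConf n) :
    ∃ i, (confCoord x).toOrd ∈ nearSet i := by
  obtain ⟨i, f, hf, rfl⟩ := mem_iUnion.1 hx
  obtain ⟨τ, hτ⟩ := exists_sorting f
  have hv (j : Fin n) : (sortedOf f τ hτ).toOrd.1 j = f.1 (τ j) := sunParam_sunCoord _
  refine ⟨τ.symm i, ?_⟩
  rw [confCoord_confProj f τ hτ]
  simp only [nearSet, mem_ofPred_eq, hv, τ.apply_symm_apply]
  exact ⟨hf.1, fun j hj => hf.2 _ fun h => hj (by rw [← h, τ.symm_apply_apply])⟩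

theorem continuousAt_confCoord {x : UConf n (Lsun 1)} (hx : x ∈ avoidConf n) :
    ContinuousAt confCoord x := by
  obtain ⟨f, rfl⟩ := confProj_surjective x
  obtain ⟨τ, hτ⟩ := exists_sorting f
  have hc (i : Fin n) : ContinuousAt (fun g : OrdConf n (Lsun 1) => sunCoord (g.1 i)) f :=
    ContinuousAt.comp (g := sunCoord) (continuousAt_sunCoord (confProj_mem_avoidConf.1 hx i))
      (OrdConf.continuous_apply i).continuousAt
  have hs : ∀ᶠ g : OrdConf n (Lsun 1) in 𝓝 f, StrictMono ((sunCoord ∘ g.1) ∘ τ) := by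
    simp only [StrictMono, Filter.eventually_all]
    exact fun i j hij => (hc (τ i)).eventually_lt (hc (τ j)) (hτ hij)
  rw [ContinuousAt, ← isOpenQuotientMap_confProj.map_nhds_eq, Filter.tendsto_map'_iff,
    tendsto_subtype_rng, tendsto_pi_nhds]
  intro i
  rw [confCoord_confProj f τ hτ]
  refine (hc (τ i)).congr' (hs.mono fun g hg => ?_)
  change _ = (confCoord (confProj n _ g)).1 i
  rw [confCoord_confProj g τ hg]
  rfl

/-- Free groups carry the discrete topology. -/
instance : TopologicalSpace (FreeGroup (Fin n)) := ⊥

instance : DiscreteTopology (FreeGroup (Fin n)) := ⟨rfl⟩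

variable [NeZero n]

theorem isOpen_startSet (k : Fin n) : IsOpen (startSet k) := by
  have h (j : Fin n) : Continuous fun y : SortedCoord n => y.1 j :=
    (continuous_apply j).comp continuous_subtype_val
  refine (isOpen_lt (h 0) continuous_const).inter (?_ : IsOpen {y | ∀ j : Fin n, j ≠ 0 → _})
  simp only [ofPred_forall, ofPred_and]
  exact isOpen_iInter_of_finite fun j => isOpen_iInter_of_finite fun _ =>
    (isOpen_iInter_of_finite fun _ => isOpen_lt ((h 0).add (h j)) continuous_const).inter
      (isOpen_iInter_of_finite fun _ => isOpen_lt ((h 0).add continuous_const) (h j))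

open Classical in
/-- The `k`-th generator on `startSet k`, extended by `1`. -/
def startLabel (y : SortedCoord n) : FreeGroup (Fin n) :=
  if h : ∃ k, y ∈ startSet k then FreeGroup.of h.choose else 1

theorem startLabel_of_mem {k : Fin n} {y : SortedCoord n} (hy : y ∈ startSet k) :
    startLabel y = FreeGroup.of k := by
  have h : ∃ k, y ∈ startSet k := ⟨k, hy⟩
  rw [startLabel, dif_pos h, startSet_unique h.choose_spec hy]

theorem startLabel_eq_one {y : SortedCoord n} (hy : ∀ k, y ∉ startSet k) : startLabel y = 1 :=
  dif_neg (not_exists.2 hy)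

theorem continuousOn_startLabel :
    ContinuousOn startLabel {y : SortedCoord n | ∃ i, y.toOrd ∈ nearSet i} := by
  rintro y ⟨i, hi⟩
  refine ContinuousAt.continuousWithinAt ?_
  have hid : StrictMono ((sunCoord ∘ y.toOrd.1) ∘ Equiv.refl (Fin n)) := fun a b hab => by
    simpa only [Function.comp_apply, Equiv.refl_apply, y.sunCoord_toOrd] using y.2.1 hab
  obtain h | h := lt_or_lt_of_vertexDist hi.1
  · obtain ⟨k, hk⟩ := exists_sortedOf_mem_startSet hi h hid
    have hy : sortedOf y.toOrd (Equiv.refl (Fin n)) hid = y :=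
      Subtype.ext (funext y.sunCoord_toOrd)
    rw [hy] at hk
    exact (continuousAt_const (y := FreeGroup.of k)).congr
      (((isOpen_startSet k).eventually_mem hk).mono fun z hz => (startLabel_of_mem hz).symm)
  · have hc : Continuous fun y : SortedCoord n => y.1 i :=
      (continuous_apply i).comp continuous_subtype_val
    rw [y.sunCoord_toOrd] at h
    have h1 := ((isOpen_nearSet i).preimage SortedCoord.continuous_toOrd).eventually_mem hi
    have h2 := (isOpen_lt continuous_const hc).eventually_mem h.1
    refine (continuousAt_const (y := (1 : FreeGroup (Fin n)))).congr
      ((h1.and h2).mono fun z ⟨hz, hz'⟩ => (startLabel_eq_one fun k hk => ?_).symm)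
    have h0 : i = 0 := by
      by_contra hne
      exact ((toOrd_mem_nearSet hk).2 i hne).not_gt (hz.2 0 (Ne.symm hne))
    subst h0
    change 3 / 4 < z.1 0 at hz'
    linarith [hk.1]

theorem startLabel_confCoord_of_notMem {x : UConf n (Lsun 1)} (hx : x ∉ avoidConf n) :
    startLabel (confCoord x) = 1 := by
  refine startLabel_eq_one fun k hk => hx ?_
  rw [← toConf_confCoord x]
  refine confProj_mem_avoidConf.2 fun j hj => ?_
  by_cases h : j = 0
  · have h1 := hk.1
    rw [← SortedCoord.sunCoord_toOrd, ← h, hj, sunCoord_sunVertex] at h1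
    norm_num at h1
  · exact ne_sunVertex_of_mem_nearSet (toOrd_mem_nearSet hk) h hj

/-- The cocycle recording which point passes through the end `0` of the loop. -/
def sunCocycle (n : ℕ) [NeZero n] : TwoChartCocycle (UConf n (Lsun 1)) (FreeGroup (Fin n)) where
  chart i := if i then avoidConf n else nearConf n
  isOpen_chart := Bool.forall_bool.2 ⟨isOpen_nearConf, isOpen_avoidConf⟩
  cover _ := mem_nearConf_of_notMem
  trans x := startLabel (confCoord x)
  continuousOn_trans := continuousOn_startLabel.comp
    (fun _ hx => (continuousAt_confCoord hx.1).continuousWithinAt)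
    fun _ hx => exists_toOrd_mem_nearSet hx.2
  trans_eq_one _ := startLabel_confCoord_of_notMem

theorem transport_linearPath (x y : UConf n (Lsun 1)) (g : FreeGroup (Fin n)) :
    (sunCocycle n).transport (.mk (linearPath x y)) g = g := by
  refine (sunCocycle n).transport_mk (linearPath x y) (fun _ => g) (Bool.forall_bool.2 ⟨?_, ?_⟩)
  · have h : ContinuousOn (fun s => startLabel (confCoord (linearPath x y s)))
        (linearPath x y ⁻¹' nearConf n) := by
      refine continuousOn_startLabel.comp (Continuous.continuousOn ?_)
        fun s hs => exists_toOrd_mem_nearSet hs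
      exact (SortedCoord.continuous_interp continuous_const continuous_const continuous_id).congr
        fun s => (confCoord_toConf _).symm
    exact (continuous_of_discreteTopology (f := fun a => a * g)).comp_continuousOn h
  · exact continuousOn_const

theorem confCoord_pullPath_mem_startSet {k : Fin n} {y : SortedCoord n} (hy : y ∈ startSet k)
    {s : I} (hs : s ≠ 1) :
    confCoord (pullPath ⟨_, toOrd_mem_nearSet hy⟩ s) ∈ startSet k := by
  set f : nearSet (0 : Fin n) := ⟨_, toOrd_mem_nearSet hy⟩ with hf
  have h0 : sunCoord ((pullConf f s).1 0) = (1 - s) * y.1 0 := by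
    rw [pullConf_self, sunCoord_pullToVertex_of_lt _ hs, y.sunCoord_toOrd]
    rw [y.sunCoord_toOrd]
    exact hy.1
  have h1 (j : Fin n) (hj : j ≠ 0) : sunCoord ((pullConf f s).1 j) = y.1 j := by
    rw [pullConf_of_ne _ _ hj, y.sunCoord_toOrd]
  have hle : (1 - s) * y.1 0 ≤ y.1 0 :=
    mul_le_of_le_one_left (y.2.2 0).1.le (sub_le_self _ s.2.1)
  have hmono : StrictMono ((sunCoord ∘ (pullConf f s).1) ∘ Equiv.refl (Fin n)) := by
    intro a b hab
    simp only [Function.comp_apply, Equiv.refl_apply]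
    rw [h1 b (ne_bot_of_gt hab)]
    by_cases ha : a = 0
    · subst ha
      rw [h0]
      exact hle.trans_lt (y.2.1 hab)
    · rw [h1 a ha]
      exact y.2.1 hab
  change confCoord (confProj n _ (pullConf f s)) ∈ _
  rw [confCoord_confProj _ _ hmono]
  have hv (j : Fin n) :
      (sortedOf (pullConf f s) (Equiv.refl _) hmono).1 j = sunCoord ((pullConf f s).1 j) := rfl
  refine ⟨?_, fun j hj => ?_⟩
  · rw [hv, h0]
    exact hle.trans_lt hy.1
  · rw [hv, hv, h0, h1 j hj]
    exact ⟨fun h => by linarith [(hy.2 j hj).1 h], fun h => by linarith [(hy.2 j hj).2 h]⟩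

theorem transport_pullPath {k : Fin n} {y : SortedCoord n} (hy : y ∈ startSet k)
    (g : FreeGroup (Fin n)) :
    (sunCocycle n).transport (.mk ⟨pullPath ⟨_, toOrd_mem_nearSet hy⟩, rfl, rfl⟩) g =
      FreeGroup.of k * g := by
  classical
  set γ := pullPath ⟨_, toOrd_mem_nearSet hy⟩ with hγ
  have h1 : γ 1 ∉ avoidConf n := fun h => confProj_mem_avoidConf.1 h 0 (by
    rw [pullConf_self, pullToVertex_one (toOrd_mem_nearSet hy).1])
  have h := (sunCocycle n).transport_mk (x := γ 0) (y := γ 1) ⟨γ, rfl, rfl⟩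
    (fun s => if s = 1 then FreeGroup.of k * g else g) (Bool.forall_bool.2 ⟨?_, ?_⟩)
  · simpa using h
  · refine (continuousOn_const (c := FreeGroup.of k * g)).congr fun s _ => ?_
    change startLabel (confCoord (γ s)) * _ = _
    by_cases hs : s = 1
    · rw [if_pos hs, hs, startLabel_confCoord_of_notMem h1, one_mul]
    · rw [if_neg hs, startLabel_of_mem (confCoord_pullPath_mem_startSet hy hs)]
  · refine (continuousOn_const (c := g)).congr fun s hs => ?_
    have hs' : s ≠ 1 := by
      rintro rfl
      exact h1 hs
    change 1 * ite _ _ _ = _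
    rw [if_neg hs', one_mul]

theorem transport_braidGen (x₀ : UConf n (Lsun 1)) (k : Fin n) (g : FreeGroup (Fin n)) :
    (sunCocycle n).transport (braidGen x₀ k).toPath g = FreeGroup.of k * g := by
  change (sunCocycle n).transport (((Path.Homotopic.Quotient.mk (linearPath x₀ _)).trans
    (.mk ⟨pullPath ⟨_, toOrd_mem_nearSet (startCoord_mem k)⟩, rfl, rfl⟩)).trans
      (Path.Homotopic.Quotient.mk (linearPath x₀ _)).symm) g = _
  rw [TwoChartCocycle.transport_trans, TwoChartCocycle.transport_trans, transport_linearPath,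
    transport_pullPath (startCoord_mem k)]
  exact TwoChartCocycle.transport_symm _ (transport_linearPath _ _ _)

theorem transport_lift_braidGen (x₀ : UConf n (Lsun 1)) (w g : FreeGroup (Fin n)) :
    (sunCocycle n).transport (FreeGroup.lift (braidGen x₀) w).toPath g = w * g := by
  have hmul (p q : FundamentalGroup (UConf n (Lsun 1)) x₀) (g : FreeGroup (Fin n)) :
      (sunCocycle n).transport (p * q).toPath g =
        (sunCocycle n).transport p.toPath ((sunCocycle n).transport q.toPath g) := by
    rw [← TwoChartCocycle.transport_trans]
    rfl
  have hone (g : FreeGroup (Fin n)) :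
      (sunCocycle n).transport (1 : FundamentalGroup (UConf n (Lsun 1)) x₀).toPath g = g :=
    (sunCocycle n).transport_refl x₀ g
  induction w using FreeGroup.induction_on generalizing g with
  | C1 => rw [map_one, hone, one_mul]
  | of k => rw [FreeGroup.lift_apply_of, transport_braidGen]
  | inv_of k ih =>
    rw [eq_inv_mul_iff_mul_eq, ← ih, ← hmul, map_inv, mul_inv_cancel, hone]
  | mul v w hv hw => rw [map_mul, hmul, hw, hv, mul_assoc]

theorem lift_braidGen_injective (x₀ : UConf n (Lsun 1)) :
    Function.Injective (FreeGroup.lift (braidGen x₀)) := fun v w h => by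
  simpa only [transport_lift_braidGen, mul_one] using
    congrArg (fun p : FundamentalGroup _ x₀ => (sunCocycle n).transport p.toPath 1) h

end Cocycle

/-- the n-string braid group of the 1-ray sun graph `L₁`
(circle with one attached ray) is free of rank `n`. -/
theorem braid_oneRaySun_free (n : ℕ) (hn : 1 ≤ n) (c : UConf n ↥(Lsun 1)) :
    Nonempty (FundamentalGroup (UConf n ↥(Lsun 1)) c ≃* FreeGroup (Fin n)) := by
  have : NeZero n := ⟨by omega⟩
  exact ⟨(MulEquiv.ofBijective (FreeGroup.lift (braidGen c))
    ⟨lift_braidGen_injective c, lift_braidGen_surjective c⟩).symm⟩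

end
end

section
/- The 2-string braid group of the n-ray sun graph L_n is a free group of rank n+1: B_2(L_n, c) ≅ F_{n+1} for any base configuration c and all n ≥ 1. -/
open Set CategoryTheory Complex

open scoped Real

noncomputable section

/-! ### Fundamental groups of spaces obtained by attaching handles -/

section VanKampen

open Topology unitInterval

variable {X ι : Type*} [TopologicalSpace X]

/-- The `G`-principal bundle glued from trivial bundles over an open cover `O` along the
transition functions `s k x * (s i x)⁻¹`. -/
def cocycleBundle {G : Type*} [Group G] [TopologicalSpace G] [DiscreteTopology G]
    (O : ι → Set X) (hO : ∀ i, IsOpen (O i)) (hcov : ∀ x, ∃ i, x ∈ O i) (s : ι → X → G)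
    (hs : ∀ i k, ∀ x ∈ O i ∩ O k, ∀ᶠ y in 𝓝 x, s k y * (s i y)⁻¹ = s k x * (s i x)⁻¹) :
    FiberBundleCore ι X G where
  baseSet := O
  isOpen_baseSet := hO
  indexAt x := (hcov x).choose
  mem_baseSet_at x := (hcov x).choose_spec
  coordChange i k x g := s k x * (s i x)⁻¹ * g
  coordChange_self i x _ v := by simp
  continuousOn_coordChange i k := by
    rintro ⟨x, g⟩ ⟨hx, -⟩
    refine ContinuousAt.continuousWithinAt ?_
    have h : ∀ᶠ p : X × G in 𝓝 (x, g),
        s k p.1 * (s i p.1)⁻¹ * p.2 = s k x * (s i x)⁻¹ * p.2 := by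
      filter_upwards [continuous_fst.continuousAt.eventually (hs i k x hx)] with p hp
      rw [hp]
    exact ContinuousAt.congr (by fun_prop) (h.mono fun p hp => hp.symm)
  coordChange_comp i j k x _ v := by group

/-- A `G`-valued cocycle on an open cover has a well-defined parallel transport along homotopy
classes of paths. -/
theorem exists_transport {G : Type*} [Group G]
    (O : ι → Set X) (hO : ∀ i, IsOpen (O i)) (hcov : ∀ x, ∃ i, x ∈ O i) (s : ι → X → G)
    (hs : ∀ i k, ∀ x ∈ O i ∩ O k, ∀ᶠ y in 𝓝 x, s k y * (s i y)⁻¹ = s k x * (s i x)⁻¹) :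
    ∃ T : ∀ x y : X, Path.Homotopic.Quotient x y → G → G,
      (∀ x g, T x x (.refl x) g = g) ∧
      (∀ x y z p q g, T x z (p.trans q) g = T y z q (T x y p g)) ∧
      (∀ i x y (γ : Path x y) g, (∀ t, γ t ∈ O i) →
        T x y (.mk γ) g = (s i y)⁻¹ * s i x * g) := by
  let _ : TopologicalSpace G := ⊥
  have : DiscreteTopology G := ⟨rfl⟩
  let Z := cocycleBundle O hO hcov s hs
  have cov : IsCoveringMap Z.proj := FiberBundle.isCoveringMap (F := G) (E := Z.Fiber)
  let c : X → G := fun x => s (Z.indexAt x) x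
  let A : ∀ x : X, G → Z.proj ⁻¹' {x} := fun x g => ⟨⟨x, (c x * g : G)⟩, rfl⟩
  let fib : Z.TotalSpace → G := fun e => e.2
  let B : ∀ x : X, Z.proj ⁻¹' {x} → G := fun x e => (c x)⁻¹ * fib e.1
  have hBA : ∀ x g, B x (A x g) = g := fun x g => by simp [A, B, fib]
  have hAB : ∀ x e, A x (B x e) = e := by
    rintro x ⟨⟨x', v⟩, h⟩
    obtain rfl : x' = x := h
    refine Subtype.ext (congrArg (Bundle.TotalSpace.mk x') ?_)
    exact mul_inv_cancel_left (c x') (v : G)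
  refine ⟨fun x y p g => B y (cov.monodromy p (A x g)), fun x g => ?_,
    fun x y z p q g => ?_, fun i x y γ g hγ => ?_⟩
  · simp only [cov.monodromy_refl, id, hBA]
  · simp only [cov.monodromy_trans_apply, hAB]
  · have hΓ : Continuous fun t => (Z.localTriv i).toOpenPartialHomeomorph.symm
        (γ t, s i x * g) := by
      refine (Z.localTriv i).toOpenPartialHomeomorph.continuousOn_symm.comp_continuous
        (by fun_prop) fun t => ?_
      exact ((Z.localTriv i).mem_target).2 (hγ t)
    have key : ∀ t, (Z.localTriv i).toOpenPartialHomeomorph.symm (γ t, s i x * g) =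
        (A (γ t) ((s i (γ t))⁻¹ * (s i x * g))).1 := by
      intro t
      rw [Z.localTriv_symm_apply]
      simp only [A, c, Z, cocycleBundle, mul_assoc]
    let Γ : Path (A x g).1 (A y ((s i y)⁻¹ * (s i x * g))).1 :=
      { toFun := fun t => (Z.localTriv i).toOpenPartialHomeomorph.symm (γ t, s i x * g)
        continuous_toFun := hΓ
        source' := by rw [key, γ.source]; simp
        target' := by rw [key, γ.target] }
    have := cov.monodromy_eq_of_map_eq (γ := .mk γ) (ex := A x g)
      (ey := A y ((s i y)⁻¹ * (s i x * g))) (.mk Γ) rfl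
    change B y (cov.monodromy (.mk γ) (A x g)) = _
    rw [this, hBA, mul_assoc]

/-- The homotopy class of a path between two points of a path-connected set, within that set. -/
def IsPathConnected.pathClass {S : Set X} (hS : IsPathConnected S) {x y : X} (hx : x ∈ S)
    (hy : y ∈ S) : Path.Homotopic.Quotient x y :=
  .mk (hS.joinedIn x hx y hy).somePath

theorem IsSimplyConnected.mk_eq_pathClass {S : Set X} (hS : IsSimplyConnected S) {x y : X}
    (γ : Path x y) (hγ : ∀ t, γ t ∈ S) (hx : x ∈ S) (hy : y ∈ S) :
    Path.Homotopic.Quotient.mk γ = hS.isPathConnected.pathClass hx hy := by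
  have := hS.simplyConnectedSpace
  have lift : ∀ δ : Path x y, (∀ t, δ t ∈ S) → ∃ δ' : Path (⟨x, hx⟩ : S) ⟨y, hy⟩,
      δ = δ'.map continuous_subtype_val := fun δ hδ =>
    ⟨{ toFun := fun t => ⟨δ t, hδ t⟩, source' := by simp, target' := by simp }, by ext; rfl⟩
  obtain ⟨γ', rfl⟩ := lift γ hγ
  obtain ⟨δ', hδ⟩ := lift _ (hS.isPathConnected.joinedIn x hx y hy).somePath_mem
  rw [IsPathConnected.pathClass, hδ, Path.Homotopic.Quotient.eq]
  exact (SimplyConnectedSpace.paths_homotopic γ' δ').map ⟨_, continuous_subtype_val⟩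

theorem IsSimplyConnected.pathClass_trans {S : Set X} (hS : IsSimplyConnected S) {x y z : X}
    (hx : x ∈ S) (hy : y ∈ S) (hz : z ∈ S) :
    (hS.isPathConnected.pathClass hx hy).trans (hS.isPathConnected.pathClass hy hz) =
      hS.isPathConnected.pathClass hx hz := by
  rw [← hS.mk_eq_pathClass
    ((hS.isPathConnected.joinedIn x hx y hy).somePath.trans
      (hS.isPathConnected.joinedIn y hy z hz).somePath) _ hx hz, Path.Homotopic.Quotient.mk_trans]
  · rfl
  · intro t
    have := mem_range_self (f := (hS.isPathConnected.joinedIn x hx y hy).somePath.trans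
      (hS.isPathConnected.joinedIn y hy z hz).somePath) t
    rw [Path.trans_range] at this
    rcases this with ⟨u, hu⟩ | ⟨u, hu⟩
    · exact hu ▸ JoinedIn.somePath_mem _ u
    · exact hu ▸ JoinedIn.somePath_mem _ u

theorem IsSimplyConnected.pathClass_self {S : Set X} (hS : IsSimplyConnected S) {x : X}
    (hx : x ∈ S) : hS.isPathConnected.pathClass hx hx = .refl x := by
  rw [← hS.mk_eq_pathClass (Path.refl x) (fun _ => hx) hx hx, Path.Homotopic.Quotient.mk_refl]

theorem IsSimplyConnected.pathClass_eq_of_subset {S R : Set X} (hS : IsSimplyConnected S)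
    (hR : IsPathConnected R) (h : R ⊆ S) {x y : X} (hx : x ∈ R) (hy : y ∈ R) :
    hS.isPathConnected.pathClass (h hx) (h hy) = hR.pathClass hx hy :=
  (hS.mk_eq_pathClass _ (fun t => h ((hR.joinedIn x hx y hy).somePath_mem t)) _ _).symm


theorem Path.Homotopic.Quotient.cast_trans {x' x y z : X} (h : x' = x)
    (p : Path.Homotopic.Quotient x y) (q : Path.Homotopic.Quotient y z) :
    (p.trans q).cast h rfl = (p.cast h rfl).trans q := by
  subst h
  simp

/-- Induction along a path: a property of homotopy classes of paths issuing from `x` holds as soon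
as it holds for the constant path and is preserved by composition with paths inside members of an
open cover. -/
theorem Path.Homotopic.Quotient.induction_cover {x y : X} (O : ι → Set X) (hO : ∀ i, IsOpen (O i))
    (hcov : ∀ x, ∃ i, x ∈ O i) (C : ∀ y, Path.Homotopic.Quotient x y → Prop)
    (hrefl : C x (.refl x))
    (hstep : ∀ i y z p (γ : Path y z), (∀ t, γ t ∈ O i) → C y p → C z (p.trans (.mk γ)))
    (p : Path.Homotopic.Quotient x y) : C y p := by
  induction p using Path.Homotopic.Quotient.ind with | mk γ => ?_
  obtain ⟨t, ht0, htm, ⟨m, hm⟩, ht⟩ := exists_monotone_Icc_subset_open_cover_unitInterval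
    (c := fun i => γ ⁻¹' O i) (fun i => (hO i).preimage γ.continuous) (fun s _ => by
      obtain ⟨i, hi⟩ := hcov (γ s)
      exact mem_iUnion.2 ⟨i, hi⟩)
  have main : ∀ k, C (γ (t k))
      ((Path.Homotopic.Quotient.mk (γ.subpath 0 (t k))).cast γ.source.symm rfl) := by
    intro k
    induction k with
    | zero =>
      have : ∀ u : I, u = 0 → C (γ u)
          ((Path.Homotopic.Quotient.mk (γ.subpath 0 u)).cast γ.source.symm rfl) := by
        rintro u rfl
        rw [Path.subpath_self]
        have : ∀ z (h : x = z), C z ((Path.Homotopic.Quotient.mk (Path.refl z)).cast h rfl) := by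
          rintro z rfl
          simpa using hrefl
        exact this _ _
      exact this _ ht0
    | succ k ih =>
      obtain ⟨i, hi⟩ := ht k
      have h := hstep i _ _ _ (γ.subpath (t k) (t (k + 1))) (fun s => by
        have hs := mem_range_self (f := γ.subpath (t k) (t (k + 1))) s
        rw [Path.range_subpath_of_le _ _ _ (htm (Nat.le_succ k))] at hs
        obtain ⟨u, hu, hus⟩ := hs
        exact hus ▸ hi hu) ih
      rw [← Path.Homotopic.Quotient.cast_trans, ← Path.Homotopic.Quotient.mk_trans] at h
      rwa [Path.Homotopic.Quotient.eq.2 ⟨Path.Homotopy.subpathTransSubpath γ 0 (t k) _⟩] at h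
  have h := main m
  rw [hm m le_rfl, Path.subpath_zero_one] at h
  have aux : ∀ z (h1 : z = y), C z ((Path.Homotopic.Quotient.mk γ).cast rfl h1) →
      C y (Path.Homotopic.Quotient.mk γ) := by
    rintro z rfl hz
    simpa using hz
  refine aux _ γ.target ?_
  simpa [Path.Homotopic.Quotient.mk_cast] using h

section Handles

variable {J : Type*} {U : Set X} {V P N : J → Set X}

/-- The loop that passes once through the handle `V j`, entering through `p j` and leaving
through `n j`. -/
def handleLoop (sU : IsPathConnected U) (sV : ∀ j, IsPathConnected (V j)) {x₀ : X} (hx₀ : x₀ ∈ U)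
    {p n : J → X} (hp : ∀ j, p j ∈ U ∩ V j) (hn : ∀ j, n j ∈ U ∩ V j) (j : J) :
    FundamentalGroup X x₀ :=
  (sU.pathClass hx₀ (hp j).1).trans
    (((sV j).pathClass (hp j).2 (hn j).2).trans (sU.pathClass (hn j).1 hx₀))

/-- Loops through distinct handles generate a free group. -/
theorem lift_handleLoop_injective (hU : IsOpen U) (hV : ∀ j, IsOpen (V j))
    (hP : ∀ j, IsOpen (P j)) (hN : ∀ j, IsOpen (N j))
    (sU : IsPathConnected U) (sV : ∀ j, IsPathConnected (V j))
    (hUV : ∀ j, U ∩ V j = P j ∪ N j) (hPN : ∀ j, Disjoint (P j) (N j))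
    (hVV : Pairwise fun i j => Disjoint (V i) (V j)) (hcov : ∀ x, x ∈ U ∨ ∃ j, x ∈ V j)
    {x₀ : X} (hx₀ : x₀ ∈ U) {p n : J → X} (hp : ∀ j, p j ∈ U ∩ V j) (hn : ∀ j, n j ∈ U ∩ V j)
    (hpP : ∀ j, p j ∈ P j) (hnN : ∀ j, n j ∈ N j) :
    Function.Injective (FreeGroup.lift (handleLoop sU sV hx₀ hp hn)) := by
  classical
  let O : Option J → Set X := fun i => i.elim U V
  let s : Option J → X → FreeGroup J := fun i x =>
    i.elim 1 fun j => if x ∈ N j then FreeGroup.of j else 1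
  have locN : ∀ j, ∀ x ∈ U ∩ V j, ∀ᶠ y in 𝓝 x, (y ∈ N j ↔ x ∈ N j) := by
    intro j x hx
    rw [hUV] at hx
    rcases hx with hx | hx
    · filter_upwards [(hP j).mem_nhds hx] with y hy
      exact ⟨fun h => ((hPN j).ne_of_mem hy h rfl).elim,
        fun h => ((hPN j).ne_of_mem hx h rfl).elim⟩
    · filter_upwards [(hN j).mem_nhds hx] with y hy
      exact ⟨fun _ => hx, fun _ => hy⟩
  obtain ⟨T, T_refl, T_trans, T_mk⟩ := exists_transport O (by rintro (_ | j); exacts [hU, hV j])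
    (fun x => (hcov x).elim (fun h => ⟨none, h⟩) fun ⟨j, h⟩ => ⟨some j, h⟩) s (by
      rintro (_ | i) (_ | k) x ⟨hi, hk⟩
      · simp
      · filter_upwards [locN k x ⟨hi, hk⟩] with y hy
        simp [s, hy]
      · filter_upwards [locN i x ⟨hk, hi⟩] with y hy
        simp [s, hy]
      · by_cases h : i = k
        · subst h
          simp
        · exact ((hVV h).ne_of_mem hi hk rfl).elim)
  have T_U : ∀ x y (hx : x ∈ U) (hy : y ∈ U) g, T x y (sU.pathClass hx hy) g = g := by
    intro x y hx hy g
    have := T_mk none x y _ g (sU.joinedIn x hx y hy).somePath_mem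
    simpa [s, IsPathConnected.pathClass] using this
  have T_loop : ∀ j g, T x₀ x₀ (handleLoop sU sV hx₀ hp hn j) g = (FreeGroup.of j)⁻¹ * g := by
    intro j g
    have h1 := T_mk (some j) _ _ _ g ((sV j).joinedIn _ (hp j).2 _ (hn j).2).somePath_mem
    have h2 : p j ∉ N j := fun h => (hPN j).ne_of_mem (hpP j) h rfl
    simp only [s, Option.elim_some, hnN j, h2, if_true, if_false, mul_one] at h1
    rw [handleLoop, T_trans, T_trans, T_U, T_U]
    exact h1
  let T₀ : FundamentalGroup X x₀ → FreeGroup J → FreeGroup J := T x₀ x₀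
  have T_one : ∀ g, T₀ 1 g = g := T_refl x₀
  have T_mul : ∀ a b g, T₀ (a * b) g = T₀ a (T₀ b g) := fun a b g => T_trans _ _ _ b a g
  have T_inv : ∀ a g h, (∀ k, T₀ a k = g * k) → T₀ a⁻¹ h = g⁻¹ * h := by
    intro a g h ha
    have h1 := ha (g⁻¹ * h)
    rw [mul_inv_cancel_left] at h1
    rw [← T_one (g⁻¹ * h), ← inv_mul_cancel a, T_mul, h1]
  let e : FreeGroup J →* FreeGroup J := FreeGroup.lift fun j => (FreeGroup.of j)⁻¹
  have he : ∀ w, e (e w) = w := fun w => by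
    have : e.comp e = MonoidHom.id _ := by
      ext j
      simp [e]
    exact DFunLike.congr_fun this w
  have key : ∀ w g, T₀ (FreeGroup.lift (handleLoop sU sV hx₀ hp hn) w) g = e w * g := by
    intro w
    induction w using FreeGroup.induction_on with
    | C1 => intro g; rw [map_one, map_one, T_one, one_mul]
    | of j => intro g; simpa [e] using T_loop j g
    | inv_of j ih => intro g; rw [map_inv, map_inv]; exact T_inv _ _ _ ih
    | mul a b iha ihb => intro g; rw [map_mul, map_mul, T_mul, ihb, iha, mul_assoc]
  rw [injective_iff_map_eq_one]
  intro w hw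
  have h := key w 1
  rw [hw, T_one, mul_one] at h
  rw [← he w, ← h, map_one]

/-- Loops through the handles generate the fundamental group. -/
theorem lift_handleLoop_surjective (hU : IsOpen U) (hV : ∀ j, IsOpen (V j))
    (sU : IsSimplyConnected U) (sV : ∀ j, IsSimplyConnected (V j))
    (cP : ∀ j, IsPathConnected (P j)) (cN : ∀ j, IsPathConnected (N j))
    (hUV : ∀ j, U ∩ V j = P j ∪ N j)
    (hVV : Pairwise fun i j => Disjoint (V i) (V j)) (hcov : ∀ x, x ∈ U ∨ ∃ j, x ∈ V j)
    {x₀ : X} (hx₀ : x₀ ∈ U) {p n : J → X} (hp : ∀ j, p j ∈ U ∩ V j) (hn : ∀ j, n j ∈ U ∩ V j)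
    (hpP : ∀ j, p j ∈ P j) (hnN : ∀ j, n j ∈ N j) :
    Function.Surjective (FreeGroup.lift
      (handleLoop sU.isPathConnected (fun j => (sV j).isPathConnected) hx₀ hp hn)) := by
  let uc {x y : X} (hx : x ∈ U) (hy : y ∈ U) := sU.isPathConnected.pathClass hx hy
  let vc (j : J) {x y : X} (hx : x ∈ V j) (hy : y ∈ V j) := (sV j).isPathConnected.pathClass hx hy
  let A : FreeGroup J → Path.Homotopic.Quotient x₀ x₀ := fun w => FreeGroup.lift
      (handleLoop sU.isPathConnected (fun j => (sV j).isPathConnected) hx₀ hp hn) w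
  have hPU : ∀ j, P j ⊆ U := fun j x hx => ((hUV j).symm ▸ Or.inl hx : x ∈ U ∩ V j).1
  have hPV : ∀ j, P j ⊆ V j := fun j x hx => ((hUV j).symm ▸ Or.inl hx : x ∈ U ∩ V j).2
  have hNU : ∀ j, N j ⊆ U := fun j x hx => ((hUV j).symm ▸ Or.inr hx : x ∈ U ∩ V j).1
  have hNV : ∀ j, N j ⊆ V j := fun j x hx => ((hUV j).symm ▸ Or.inr hx : x ∈ U ∩ V j).2
  have uv_P : ∀ j x (hx : x ∈ P j),
      uc (hp j).1 (hPU j hx) = vc j (hp j).2 (hPV j hx) := fun j x hx =>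
    (sU.pathClass_eq_of_subset (cP j) (hPU j) (hpP j) hx).trans
      ((sV j).pathClass_eq_of_subset (cP j) (hPV j) (hpP j) hx).symm
  have uv_N : ∀ j x (hx : x ∈ N j),
      uc (hn j).1 (hNU j hx) = vc j (hn j).2 (hNV j hx) := fun j x hx =>
    (sU.pathClass_eq_of_subset (cN j) (hNU j) (hnN j) hx).trans
      ((sV j).pathClass_eq_of_subset (cN j) (hNV j) (hnN j) hx).symm
  have ucomp : ∀ {x y z : X} (hx : x ∈ U) (hy : y ∈ U) (hz : z ∈ U),
    (uc hx hy).trans (uc hy hz) = uc hx hz := fun hx hy hz => sU.pathClass_trans hx hy hz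
  have vcomp : ∀ j {x y z : X} (hx : x ∈ V j) (hy : y ∈ V j) (hz : z ∈ V j),
    (vc j hx hy).trans (vc j hy hz) = vc j hx hz := fun j _ _ _ hx hy hz =>
      (sV j).pathClass_trans hx hy hz
  have hgen : ∀ w j, A (FreeGroup.of j * w) = (A w).trans
      ((uc hx₀ (hp j).1).trans ((vc j (hp j).2 (hn j).2).trans (uc (hn j).1 hx₀))) := by
    intro w j
    simp only [A, map_mul, FreeGroup.lift_apply_of]
    rfl
  let CU : ∀ y, Path.Homotopic.Quotient x₀ y → Prop := fun y q =>
    ∃ (hy : y ∈ U) (w : FreeGroup J), q = (A w).trans (uc hx₀ hy)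
  let CV : J → ∀ y, Path.Homotopic.Quotient x₀ y → Prop := fun j y q =>
    ∃ (hy : y ∈ V j) (w : FreeGroup J), q = (A w).trans ((uc hx₀ (hp j).1).trans (vc j (hp j).2 hy))
  have U_to_V : ∀ j y q, y ∈ V j → CU y q → CV j y q := by
    rintro j y q hyV ⟨hy, w, rfl⟩
    refine ⟨hyV, ?_⟩
    rcases (hUV j ▸ ⟨hy, hyV⟩ : y ∈ P j ∪ N j) with h | h
    · refine ⟨w, ?_⟩
      rw [← uv_P j y h, ucomp]
    · refine ⟨(FreeGroup.of j)⁻¹ * w, ?_⟩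
      have hw := hgen ((FreeGroup.of j)⁻¹ * w) j
      rw [mul_inv_cancel_left] at hw
      rw [hw]
      simp only [Path.Homotopic.Quotient.trans_assoc]
      rw [ucomp, uv_N j y h, vcomp]
  have V_to_U : ∀ j y q, y ∈ U → CV j y q → CU y q := by
    rintro j y q hy ⟨hyV, w, rfl⟩
    refine ⟨hy, ?_⟩
    rcases (hUV j ▸ ⟨hy, hyV⟩ : y ∈ P j ∪ N j) with h | h
    · refine ⟨w, ?_⟩
      rw [← uv_P j y h, ucomp]
    · refine ⟨FreeGroup.of j * w, ?_⟩
      rw [hgen]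
      simp only [Path.Homotopic.Quotient.trans_assoc]
      rw [ucomp, uv_N j y h, vcomp]
  intro q
  have main : CU x₀ q ∨ ∃ j, CV j x₀ q := by
    refine Path.Homotopic.Quotient.induction_cover (fun i : Option J => i.elim U V)
      (by rintro (_ | j); exacts [hU, hV j])
      (fun x => (hcov x).elim (fun h => ⟨none, h⟩) fun ⟨j, h⟩ => ⟨some j, h⟩)
      (fun y q => CU y q ∨ ∃ j, CV j y q) (Or.inl ⟨hx₀, 1, ?_⟩) ?_ q
    · have h1 : A 1 = .refl x₀ := map_one (FreeGroup.lift
        (handleLoop sU.isPathConnected (fun j => (sV j).isPathConnected) hx₀ hp hn))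
      have h2 : uc hx₀ hx₀ = .refl x₀ := sU.pathClass_self hx₀
      rw [h1, h2, Path.Homotopic.Quotient.trans_refl]
    · rintro (_ | i) y z q γ hγ hq
      · have hy : y ∈ U := by simpa using hγ 0
        have hz : z ∈ U := by simpa using hγ 1
        have hq' : CU y q := hq.elim id fun ⟨j, h⟩ => V_to_U j y q hy h
        obtain ⟨_, w, rfl⟩ := hq'
        refine Or.inl ⟨hz, w, ?_⟩
        have h : Path.Homotopic.Quotient.mk γ = uc hy hz := sU.mk_eq_pathClass γ hγ hy hz
        rw [h, Path.Homotopic.Quotient.trans_assoc, ucomp]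
      · have hy : y ∈ V i := by simpa using hγ 0
        have hz : z ∈ V i := by simpa using hγ 1
        have hq' : CV i y q := by
          rcases hq with h | ⟨j, h⟩
          · exact U_to_V i y q hy h
          · by_cases hij : i = j
            · exact hij ▸ h
            · exact ((hVV hij).ne_of_mem hy h.1 rfl).elim
        obtain ⟨_, w, rfl⟩ := hq'
        refine Or.inr ⟨i, hz, w, ?_⟩
        have h : Path.Homotopic.Quotient.mk γ = vc i hy hz := (sV i).mk_eq_pathClass γ hγ hy hz
        rw [h]
        simp only [Path.Homotopic.Quotient.trans_assoc]
        rw [vcomp]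
  obtain ⟨_, w, hw⟩ : CU x₀ q := main.elim id fun ⟨j, h⟩ => V_to_U j x₀ q hx₀ h
  refine ⟨w, ?_⟩
  have h2 : uc hx₀ hx₀ = .refl x₀ := sU.pathClass_self hx₀
  rw [h2, Path.Homotopic.Quotient.trans_refl] at hw
  exact hw.symm

/-- If a space is obtained from a simply connected open set `U` by attaching disjoint simply
connected open handles `V j`, each meeting `U` in two disjoint path-connected open sets, then its
fundamental group is free on the set of handles. -/
theorem nonempty_fundamentalGroup_mulEquiv_freeGroup (hU : IsOpen U) (hV : ∀ j, IsOpen (V j))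
    (hP : ∀ j, IsOpen (P j)) (hN : ∀ j, IsOpen (N j))
    (sU : IsSimplyConnected U) (sV : ∀ j, IsSimplyConnected (V j))
    (cP : ∀ j, IsPathConnected (P j)) (cN : ∀ j, IsPathConnected (N j))
    (hUV : ∀ j, U ∩ V j = P j ∪ N j) (hPN : ∀ j, Disjoint (P j) (N j))
    (hVV : Pairwise fun i j => Disjoint (V i) (V j)) (hcov : ∀ x, x ∈ U ∨ ∃ j, x ∈ V j) (x : X) :
    Nonempty (FundamentalGroup X x ≃* FreeGroup J) := by
  obtain ⟨x₀, hx₀⟩ := sU.isPathConnected.nonempty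
  choose p hpP using fun j => (cP j).nonempty
  choose n hnN using fun j => (cN j).nonempty
  have hp : ∀ j, p j ∈ U ∩ V j := fun j => hUV j ▸ Or.inl (hpP j)
  have hn : ∀ j, n j ∈ U ∩ V j := fun j => hUV j ▸ Or.inr (hnN j)
  have hj : ∀ y, Joined x₀ y := fun y => by
    rcases hcov y with hy | ⟨j, hy⟩
    · exact (sU.isPathConnected.joinedIn x₀ hx₀ y hy).joined
    · exact (sU.isPathConnected.joinedIn x₀ hx₀ (p j) (hp j).1).joined.trans
        ((sV j).isPathConnected.joinedIn (p j) (hp j).2 y hy).joined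
  have : PathConnectedSpace X := ⟨⟨x₀⟩, fun y z => (hj y).symm.trans (hj z)⟩
  exact ⟨(FundamentalGroup.fundamentalGroupMulEquivOfPathConnected x x₀).trans
    (MulEquiv.ofBijective _
      ⟨lift_handleLoop_injective hU hV hP hN sU.isPathConnected (fun j => (sV j).isPathConnected)
        hUV hPN hVV hcov hx₀ hp hn hpP hnN,
      lift_handleLoop_surjective hU hV sU sV cP cN hUV hVV hcov hx₀ hp hn hpP hnN⟩).symm⟩

end Handles

end VanKampen
/-! ### Charts of the unordered configuration space of two points -/

section UnorderedPairs

open Topology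

variable {Y : Type*} [TopologicalSpace Y]

/-- The configuration `{x, y}`. -/
def UConf.pair (x y : Y) (h : x ≠ y) : UConf 2 Y :=
  ⟨{x, y}, Set.toFinite _, Set.ncard_pair h⟩

/-- The configurations `{x, y}` with `(x, y) ∈ K`. -/
def UConf.ofRel (K : Set (Y × Y)) : Set (UConf 2 Y) :=
  {s | ∃ p ∈ K, s.1 = {p.1, p.2}}

theorem UConf.exists_eq_pair (s : UConf 2 Y) : ∃ x y, ∃ h : x ≠ y, s = UConf.pair x y h := by
  obtain ⟨x, y, h, hs⟩ := Set.ncard_eq_two.1 s.2.2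
  exact ⟨x, y, h, Subtype.ext hs⟩

theorem UConf.pair_mem_ofRel {K : Set (Y × Y)} {x y : Y} (h : x ≠ y) :
    UConf.pair x y h ∈ UConf.ofRel K ↔ (x, y) ∈ K ∨ (y, x) ∈ K := by
  constructor
  · rintro ⟨⟨u, v⟩, hK, hs⟩
    rcases Set.pair_eq_pair_iff.1 hs with ⟨rfl, rfl⟩ | ⟨rfl, rfl⟩
    exacts [Or.inl hK, Or.inr hK]
  · rintro (hK | hK)
    exacts [⟨_, hK, rfl⟩, ⟨_, hK, Set.pair_comm _ _⟩]

theorem confProj_two (f : OrdConf 2 Y) :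
    confProj 2 Y f = UConf.pair (f.1 0) (f.1 1) (fun h => zero_ne_one (f.2 h)) := by
  refine Subtype.ext ?_
  ext z
  simp [confProj, UConf.pair, Fin.exists_fin_two, eq_comm]

theorem UConf.isOpen_ofRel {K : Set (Y × Y)} (hK : IsOpen K) : IsOpen (UConf.ofRel K) := by
  refine isOpen_coinduced.2 ?_
  have h0 : ∀ i, Continuous fun f : OrdConf 2 Y => f.1 i := fun i =>
    (continuous_apply i).comp continuous_subtype_val
  have : confProj 2 Y ⁻¹' UConf.ofRel K =
      {f | (f.1 0, f.1 1) ∈ K} ∪ {f | (f.1 1, f.1 0) ∈ K} := by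
    ext f
    rw [mem_preimage, confProj_two, UConf.pair_mem_ofRel]
    rfl
  rw [this]
  exact (hK.preimage ((h0 0).prodMk (h0 1))).union (hK.preimage ((h0 1).prodMk (h0 0)))

theorem UConf.isSimplyConnected_ofRel {K : Set (Y × Y)} (hK : IsOpen K)
    (hasymm : ∀ x y, (x, y) ∈ K → (y, x) ∉ K) (hs : IsSimplyConnected K) :
    IsSimplyConnected (UConf.ofRel K) := by
  have hne : ∀ p : K, p.1.1 ≠ p.1.2 := by
    rintro ⟨⟨x, y⟩, hp⟩ h
    obtain rfl : x = y := h
    exact hasymm _ _ hp hp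
  let F : K → UConf 2 Y := fun p => UConf.pair p.1.1 p.1.2 (hne p)
  have hF : Continuous F := by
    let G : K → OrdConf 2 Y := fun p => ⟨![p.1.1, p.1.2], by
      intro i j hij
      fin_cases i <;> fin_cases j <;> simp_all [(hne p).symm]⟩
    have hG : Continuous G := by
      refine Continuous.subtype_mk (continuous_pi fun i => ?_) _
      fin_cases i
      · exact continuous_fst.comp continuous_subtype_val
      · exact continuous_snd.comp continuous_subtype_val
    have hFG : F = confProj 2 Y ∘ G := by
      funext p
      rw [Function.comp_apply, confProj_two]
      rfl
    rw [hFG]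
    exact continuous_coinduced_rng.comp hG
  have hinj : Function.Injective F := by
    rintro ⟨⟨x, y⟩, hp⟩ ⟨⟨u, v⟩, hq⟩ h
    rcases Set.pair_eq_pair_iff.1 (congrArg Subtype.val h) with ⟨h1, h2⟩ | ⟨h1, h2⟩
    · exact Subtype.ext (Prod.ext h1 h2)
    · obtain rfl : x = v := h1
      obtain rfl : y = u := h2
      exact (hasymm _ _ hp hq).elim
  have hopen : IsOpenMap F := by
    intro W hW
    have : F '' W = UConf.ofRel (Subtype.val '' W) := by
      ext s
      constructor
      · rintro ⟨p, hp, rfl⟩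
        exact ⟨p.1, ⟨p, hp, rfl⟩, rfl⟩
      · rintro ⟨_, ⟨p, hp, rfl⟩, hs⟩
        exact ⟨p, hp, Subtype.ext hs.symm⟩
    rw [this]
    exact UConf.isOpen_ofRel (hK.isOpenMap_subtype_val _ hW)
  have hemb : IsEmbedding F := (IsOpenEmbedding.of_continuous_injective_isOpenMap hF hinj
    hopen).isEmbedding
  have hrange : F '' univ = UConf.ofRel K := by
    ext s
    constructor
    · rintro ⟨p, -, rfl⟩
      exact ⟨p.1, p.2, rfl⟩
    · rintro ⟨p, hp, hs⟩
      exact ⟨⟨p, hp⟩, trivial, Subtype.ext hs.symm⟩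
  rw [← hrange, hemb.isSimplyConnected_image, ← IsEmbedding.subtypeVal.isSimplyConnected_image]
  simpa using hs

theorem UConf.disjoint_ofRel {K L : Set (Y × Y)}
    (h : ∀ x y, (x, y) ∈ K → (x, y) ∉ L ∧ (y, x) ∉ L) :
    Disjoint (UConf.ofRel K) (UConf.ofRel L) := by
  rw [Set.disjoint_left]
  intro s hK hL
  obtain ⟨x, y, hxy, rfl⟩ := s.exists_eq_pair
  rw [UConf.pair_mem_ofRel] at hK hL
  rcases hK with hK | hK
  · exact hL.elim (h _ _ hK).1 (h _ _ hK).2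
  · exact hL.elim (h _ _ hK).2 (h _ _ hK).1

theorem UConf.ofRel_inter_ofRel {K L P N : Set (Y × Y)} (hP : P ⊆ L) (hN : N ⊆ L)
    (h : ∀ x y, (x, y) ∈ L → (((x, y) ∈ K ∨ (y, x) ∈ K) ↔ ((x, y) ∈ P ∨ (x, y) ∈ N))) :
    UConf.ofRel K ∩ UConf.ofRel L = UConf.ofRel P ∪ UConf.ofRel N := by
  ext s
  obtain ⟨x, y, hxy, rfl⟩ := s.exists_eq_pair
  simp only [mem_inter_iff, mem_union, UConf.pair_mem_ofRel]
  constructor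
  · rintro ⟨hK, hL | hL⟩
    · exact ((h _ _ hL).1 hK).imp Or.inl Or.inl
    · exact ((h _ _ hL).1 hK.symm).imp Or.inr Or.inr
  · rintro ((hp | hp) | (hp | hp))
    · exact ⟨(h _ _ (hP hp)).2 (Or.inl hp), Or.inl (hP hp)⟩
    · exact ⟨((h _ _ (hP hp)).2 (Or.inl hp)).symm, Or.inr (hP hp)⟩
    · exact ⟨(h _ _ (hN hp)).2 (Or.inr hp), Or.inl (hN hp)⟩
    · exact ⟨((h _ _ (hN hp)).2 (Or.inr hp)).symm, Or.inr (hN hp)⟩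

end UnorderedPairs

/-! ### Polar coordinates on pairs of points of the plane -/

section Polar

open Topology

/-- The pairs of nonzero complex numbers whose angles with respect to `a` and `b` lie in `C` and
whose moduli lie in `Q`. -/
def polarSet (a b : ℂ) (C Q : Set (ℝ × ℝ)) : Set (ℂ × ℂ) :=
  {p | p.1 ≠ 0 ∧ p.2 ≠ 0 ∧ (arg (p.1 / a), arg (p.2 / b)) ∈ C ∧ (‖p.1‖, ‖p.2‖) ∈ Q}

theorem mem_slitPlane_of_abs_arg_lt {z : ℂ} (hz : z ≠ 0) (h : |arg z| < π) : z ∈ slitPlane :=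
  mem_slitPlane_iff_arg.2 ⟨fun h' => by rw [h', abs_of_pos Real.pi_pos] at h; exact h.ne rfl, hz⟩

theorem isOpen_polarSet {a b : ℂ} (ha : a ≠ 0) (hb : b ≠ 0) {C Q : Set (ℝ × ℝ)} (hC : IsOpen C)
    (hQ : IsOpen Q) (hCπ : ∀ c ∈ C, |c.1| < π ∧ |c.2| < π) : IsOpen (polarSet a b C Q) := by
  rw [isOpen_iff_mem_nhds]
  rintro ⟨x, y⟩ ⟨hx, hy, hc, hq⟩
  have h1 : ContinuousAt (fun p : ℂ × ℂ => arg (p.1 / a)) (x, y) :=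
    ContinuousAt.comp (f := fun p : ℂ × ℂ => p.1 / a) (continuousAt_arg
      (mem_slitPlane_of_abs_arg_lt (div_ne_zero hx ha) (hCπ _ hc).1)) (by fun_prop)
  have h2 : ContinuousAt (fun p : ℂ × ℂ => arg (p.2 / b)) (x, y) :=
    ContinuousAt.comp (f := fun p : ℂ × ℂ => p.2 / b) (continuousAt_arg
      (mem_slitPlane_of_abs_arg_lt (div_ne_zero hy hb) (hCπ _ hc).2)) (by fun_prop)
  have h3 : ContinuousAt (fun p : ℂ × ℂ => (‖p.1‖, ‖p.2‖)) (x, y) := by fun_prop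
  filter_upwards [continuousAt_fst.eventually_ne hx, continuousAt_snd.eventually_ne hy,
    (h1.prodMk h2).eventually (hC.mem_nhds hc), h3.eventually (hQ.mem_nhds hq)] with p p1 p2 p3 p4
  exact ⟨p1, p2, p3, p4⟩

theorem norm_mul_exp_arg_div {a z : ℂ} (ha : ‖a‖ = 1) :
    (‖z‖ : ℂ) * a * exp (arg (z / a) * I) = z := by
  have ha0 : a ≠ 0 := norm_ne_zero_iff.1 (by simp [ha])
  have := norm_mul_exp_arg_mul_I (z / a)
  rw [norm_div, ha, div_one] at this
  rw [mul_right_comm, this, div_mul_cancel₀ _ ha0]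

theorem arg_smul_div {a z : ℂ} {r : ℝ} (hr : 0 < r) : arg (r • z / a) = arg (z / a) := by
  rw [real_smul, mul_div_assoc, arg_real_mul _ hr]

theorem arg_mul_mul_exp_div {a : ℂ} (ha : a ≠ 0) {r c : ℝ} (hr : 0 < r) (hc : |c| < π) :
    arg ((r : ℂ) * a * exp (c * I) / a) = c := by
  rw [mul_right_comm, mul_div_cancel_right₀ _ ha, arg_real_mul _ hr, arg_exp_mul_I,
    toIocMod_eq_self]
  rw [abs_lt] at hc
  constructor <;> linarith

/-- A set of pairs of points which retracts radially onto the image of a convex set of angles is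
simply connected. -/
theorem isSimplyConnected_of_polar {K : Set (ℂ × ℂ)} {a b : ℂ} (ha : ‖a‖ = 1) (hb : ‖b‖ = 1)
    {r₁ r₂ : ℝ} (hr₁ : 0 < r₁) (hr₂ : 0 < r₂) {C : Set (ℝ × ℝ)} (hC : Convex ℝ C)
    (hne : C.Nonempty) (hCπ : ∀ c ∈ C, |c.1| < π ∧ |c.2| < π)
    (hKC : ∀ p ∈ K, p.1 ≠ 0 ∧ p.2 ≠ 0 ∧ (arg (p.1 / a), arg (p.2 / b)) ∈ C)
    (hCK : ∀ c ∈ C, ((r₁ : ℂ) * a * exp (c.1 * I), (r₂ : ℂ) * b * exp (c.2 * I)) ∈ K)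
    (hrad : ∀ p ∈ K, ∀ t ∈ Icc (0 : ℝ) 1,
      ((1 - t + t * (r₁ / ‖p.1‖)) • p.1, (1 - t + t * (r₂ / ‖p.2‖)) • p.2) ∈ K) :
    IsSimplyConnected K := by
  have ha0 : a ≠ 0 := norm_ne_zero_iff.1 (by simp [ha])
  have hb0 : b ≠ 0 := norm_ne_zero_iff.1 (by simp [hb])
  let F : C(K, C) := ⟨fun p => ⟨_, (hKC p.1 p.2).2.2⟩, by
    refine Continuous.subtype_mk (continuous_iff_continuousAt.2 fun p => ?_) _
    obtain ⟨h1, h2, h3⟩ := hKC p.1 p.2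
    refine ContinuousAt.prodMk ?_ ?_
    · exact ContinuousAt.comp (f := fun p : K => p.1.1 / a) (continuousAt_arg
        (mem_slitPlane_of_abs_arg_lt (div_ne_zero h1 ha0) (hCπ _ h3).1)) (by fun_prop)
    · exact ContinuousAt.comp (f := fun p : K => p.1.2 / b) (continuousAt_arg
        (mem_slitPlane_of_abs_arg_lt (div_ne_zero h2 hb0) (hCπ _ h3).2)) (by fun_prop)⟩
  let E : C(C, K) := ⟨fun c => ⟨_, hCK c.1 c.2⟩, Continuous.subtype_mk (by fun_prop) _⟩
  let H : ContinuousMap.Homotopy (ContinuousMap.id K) (E.comp F) :=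
    { toFun := fun q => ⟨_, hrad q.2.1 q.2.2 q.1 q.1.2⟩
      continuous_toFun := by
        refine Continuous.subtype_mk ?_ _
        have h1 : ∀ q : unitInterval × K, ‖q.2.1.1‖ ≠ 0 := fun q =>
          norm_ne_zero_iff.2 (hKC q.2.1 q.2.2).1
        have h2 : ∀ q : unitInterval × K, ‖q.2.1.2‖ ≠ 0 := fun q =>
          norm_ne_zero_iff.2 (hKC q.2.1 q.2.2).2.1
        fun_prop (disch := assumption)
      map_zero_left := fun p => by
        refine Subtype.ext (Prod.ext ?_ ?_) <;> simp
      map_one_left := fun p => by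
        have h1 : (‖p.1.1‖ : ℂ) ≠ 0 := by
          exact_mod_cast norm_ne_zero_iff.2 (hKC p.1 p.2).1
        have h2 : (‖p.1.2‖ : ℂ) ≠ 0 := by
          exact_mod_cast norm_ne_zero_iff.2 (hKC p.1 p.2).2.1
        have e1 := norm_mul_exp_arg_div (z := p.1.1) ha
        have e2 := norm_mul_exp_arg_div (z := p.1.2) hb
        refine Subtype.ext (Prod.ext ?_ ?_)
        · change (1 - 1 + 1 * (r₁ / ‖p.1.1‖)) • p.1.1 = (r₁ : ℂ) * a * exp (arg (p.1.1 / a) * I)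
          rw [sub_self, zero_add, one_mul, real_smul]
          push_cast
          rw [div_mul_eq_mul_div, div_eq_iff h1]
          nth_rw 1 [← e1]
          ring
        · change (1 - 1 + 1 * (r₂ / ‖p.1.2‖)) • p.1.2 = (r₂ : ℂ) * b * exp (arg (p.1.2 / b) * I)
          rw [sub_self, zero_add, one_mul, real_smul]
          push_cast
          rw [div_mul_eq_mul_div, div_eq_iff h2]
          nth_rw 1 [← e2]
          ring }
  have hFE : F.comp E = ContinuousMap.id C := by
    ext1 c
    refine Subtype.ext (Prod.ext ?_ ?_)
    · exact arg_mul_mul_exp_div ha0 hr₁ (hCπ _ c.2).1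
    · exact arg_mul_mul_exp_div hb0 hr₂ (hCπ _ c.2).2
  have : ContractibleSpace C := hC.contractibleSpace hne
  have e : ContinuousMap.HomotopyEquiv K C :=
    ⟨F, E, ⟨H.symm⟩, hFE ▸ ContinuousMap.Homotopic.refl _⟩
  have : ContractibleSpace K := e.contractibleSpace
  exact SimplyConnectedSpace.ofContractible K

end Polar

/-! ### The sun graph -/

section Sun

open Topology

/-- The direction of the `j`-th arm of the `n`-ray sun graph. -/
def armDir (n j : ℕ) : ℂ := exp (2 * Real.pi * j / n * I)

/-- The direction halfway between two consecutive arms of the `n`-ray sun graph. -/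
def gapDir (n : ℕ) : ℂ := exp ((π / n : ℝ) * I)

theorem norm_armDir (n j : ℕ) : ‖armDir n j‖ = 1 := by
  have : armDir n j = exp ((2 * π * j / n : ℝ) * I) := by
    rw [armDir]
    push_cast
    rfl
  rw [this, norm_exp_ofReal_mul_I]

theorem norm_gapDir (n : ℕ) : ‖gapDir n‖ = 1 := norm_exp_ofReal_mul_I _

theorem armDir_ne_zero (n j : ℕ) : armDir n j ≠ 0 := exp_ne_zero _

theorem gapDir_ne_zero (n : ℕ) : gapDir n ≠ 0 := exp_ne_zero _

theorem armDir_eq_pow (n j : ℕ) : armDir n j = exp (2 * π * I / n) ^ j := by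
  rw [armDir, ← exp_nat_mul]
  congr 1
  ring

theorem armDir_pow {n : ℕ} (hn : 1 ≤ n) (j : ℕ) : armDir n j ^ n = 1 := by
  rw [armDir_eq_pow, ← pow_mul, mul_comm j n, pow_mul,
    (isPrimitiveRoot_exp n (by lia)).pow_eq_one, one_pow]

theorem armDir_injective {n : ℕ} (hn : 1 ≤ n) {i j : ℕ} (hi : i < n) (hj : j < n)
    (h : armDir n i = armDir n j) : i = j := by
  rw [armDir_eq_pow, armDir_eq_pow] at h
  exact (isPrimitiveRoot_exp n (by lia)).pow_inj hi hj h

theorem gapDir_pow {n : ℕ} (hn : 1 ≤ n) : gapDir n ^ n = -1 := by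
  have : (n : ℂ) ≠ 0 := by exact_mod_cast (by lia : n ≠ 0)
  rw [gapDir, ← exp_nat_mul, ← exp_pi_mul_I]
  congr 1
  push_cast
  field_simp

variable {n : ℕ}

theorem smul_armDir_mem {j : ℕ} (hj : j < n) {r : ℝ} (h1 : 1 ≤ r) (h2 : r ≤ 2) :
    (r : ℂ) * armDir n j ∈ Lsun n :=
  Or.inr (mem_biUnion (Finset.mem_coe.2 (Finset.mem_range.2 hj)) ⟨r, h1, h2, rfl⟩)

theorem Lsun.mem_of_norm_eq_one {z : ℂ} (h : ‖z‖ = 1) : z ∈ Lsun n :=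
  Or.inl (mem_sphere_zero_iff_norm.2 h)

theorem Lsun.cases {z : ℂ} (hz : z ∈ Lsun n) :
    ‖z‖ = 1 ∨ ∃ j < n, 1 < ‖z‖ ∧ ‖z‖ ≤ 2 ∧ z = ‖z‖ * armDir n j := by
  rcases hz with hz | hz
  · exact Or.inl (mem_sphere_zero_iff_norm.1 hz)
  · obtain ⟨j, hj, r, h1, h2, rfl⟩ := by simpa only [mem_iUnion, exists_prop] using hz
    change ‖(r : ℂ) * armDir n j‖ = 1 ∨ ∃ k < n, 1 < ‖(r : ℂ) * armDir n j‖ ∧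
      ‖(r : ℂ) * armDir n j‖ ≤ 2 ∧ (r : ℂ) * armDir n j = ‖(r : ℂ) * armDir n j‖ * armDir n k
    have hr : ‖(r : ℂ) * armDir n j‖ = r := by
      rw [norm_mul, norm_armDir, mul_one, norm_real, Real.norm_of_nonneg (by linarith)]
    rw [hr]
    rcases h1.eq_or_lt with h | h
    · exact Or.inl h.symm
    · exact Or.inr ⟨j, Finset.mem_range.1 hj, h, h2, rfl⟩

theorem Lsun.one_le_norm {z : ℂ} (hz : z ∈ Lsun n) : 1 ≤ ‖z‖ := by
  rcases Lsun.cases hz with h | ⟨j, -, h, -⟩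
  exacts [h.ge, h.le]

theorem Lsun.ne_zero {z : ℂ} (hz : z ∈ Lsun n) : z ≠ 0 :=
  norm_pos_iff.1 (zero_lt_one.trans_le (Lsun.one_le_norm hz))

theorem radial_pos {z : ℂ} (hz : z ≠ 0) {r t : ℝ} (hr : 0 < r) (ht : t ∈ Icc (0 : ℝ) 1) :
    0 < 1 - t + t * (r / ‖z‖) := by
  have : 0 < r / ‖z‖ := div_pos hr (norm_pos_iff.2 hz)
  rcases ht.1.eq_or_lt with h | h
  · rw [← h]
    norm_num
  · have := mul_pos h this
    linarith [ht.2]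

theorem norm_radial {z : ℂ} (hz : z ≠ 0) {r t : ℝ} (hr : 0 < r) (ht : t ∈ Icc (0 : ℝ) 1) :
    ‖(1 - t + t * (r / ‖z‖)) • z‖ = (1 - t) * ‖z‖ + t * r := by
  have := norm_ne_zero_iff.2 hz
  rw [norm_smul, Real.norm_of_nonneg (radial_pos hz hr ht).le]
  field_simp

theorem Lsun.radial_mem {z : ℂ} (hz : z ∈ Lsun n) {t : ℝ} (ht : t ∈ Icc (0 : ℝ) 1) :
    (1 - t + t * (1 / ‖z‖)) • z ∈ Lsun n := by
  have hr := norm_radial (Lsun.ne_zero hz) one_pos ht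
  rcases Lsun.cases hz with h | ⟨j, hj, h1, h2, h⟩
  · refine Lsun.mem_of_norm_eq_one ?_
    rw [hr, h]
    ring
  · have : (1 - t + t * (1 / ‖z‖)) • z = (((1 - t) * ‖z‖ + t * 1 : ℝ) : ℂ) * armDir n j := by
      have h0 : (‖z‖ : ℂ) ≠ 0 := by exact_mod_cast norm_ne_zero_iff.2 (Lsun.ne_zero hz)
      rw [real_smul]
      nth_rw 2 [h]
      push_cast
      field_simp
    rw [this]
    refine smul_armDir_mem hj ?_ ?_ <;> nlinarith [ht.1, ht.2]

theorem Lsun.radial_mem_of_one_lt {z : ℂ} (hz : z ∈ Lsun n) (h1 : 1 < ‖z‖) {t : ℝ}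
    (ht : t ∈ Icc (0 : ℝ) 1) : (1 - t + t * (2 / ‖z‖)) • z ∈ Lsun n := by
  rcases Lsun.cases hz with h | ⟨j, hj, -, h2, h⟩
  · exact absurd h h1.ne'
  · have : (1 - t + t * (2 / ‖z‖)) • z = (((1 - t) * ‖z‖ + t * 2 : ℝ) : ℂ) * armDir n j := by
      have h0 : (‖z‖ : ℂ) ≠ 0 := by exact_mod_cast norm_ne_zero_iff.2 (Lsun.ne_zero hz)
      rw [real_smul]
      nth_rw 2 [h]
      push_cast
      field_simp
    rw [this]
    refine smul_armDir_mem hj ?_ ?_ <;> nlinarith [ht.1, ht.2]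

/-- Half the angle within which a point of the sun graph is regarded as close to a direction. -/
def sunAngle (n : ℕ) : ℝ := π / (2 * n)

theorem sunAngle_pos (hn : 1 ≤ n) : 0 < sunAngle n := by
  have : (0 : ℝ) < n := by exact_mod_cast hn
  exact div_pos Real.pi_pos (by linarith)

theorem sunAngle_le (hn : 1 ≤ n) : sunAngle n ≤ π / 2 := by
  have : (1 : ℝ) ≤ n := by exact_mod_cast hn
  exact div_le_div_of_nonneg_left Real.pi_pos.le two_pos (by linarith)

theorem abs_mul_sub_lt {α β : ℝ} (hn : 1 ≤ n) (hα : |α| < sunAngle n) (hβ : |β| < sunAngle n) :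
    |n * (α - β)| < π := by
  have h0 : (0 : ℝ) < n := by exact_mod_cast hn
  have h1 : n * sunAngle n = π / 2 := by
    rw [sunAngle]
    field_simp
  rw [abs_mul, abs_of_pos h0]
  have := abs_sub α β
  nlinarith

theorem mul_exp_arg_div_eq {a b z : ℂ} (ha : ‖a‖ = 1) (hb : ‖b‖ = 1) (hz : z ≠ 0) :
    a * exp (arg (z / a) * I) = b * exp (arg (z / b) * I) := by
  have h0 : (‖z‖ : ℂ) ≠ 0 := by exact_mod_cast norm_ne_zero_iff.2 hz
  refine mul_left_cancel₀ h0 ?_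
  rw [← mul_assoc, ← mul_assoc, norm_mul_exp_arg_div ha, norm_mul_exp_arg_div hb]

theorem pow_mul_exp_eq {a b z : ℂ} (ha : ‖a‖ = 1) (hb : ‖b‖ = 1) (hz : z ≠ 0) :
    a ^ n * exp ((n * (arg (z / a) - arg (z / b)) : ℝ) * I) = b ^ n := by
  have h1 := congrArg (· ^ n) (mul_exp_arg_div_eq ha hb hz)
  simp only [mul_pow, ← exp_nat_mul] at h1
  have h2 : ((n * (arg (z / a) - arg (z / b)) : ℝ) * I : ℂ) =
      n * (arg (z / a) * I) - n * (arg (z / b) * I) := by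
    push_cast
    ring
  rw [h2, exp_sub, ← mul_div_assoc, h1, mul_div_cancel_right₀ _ (exp_ne_zero _)]

theorem not_near_gapDir_and_armDir (hn : 1 ≤ n) {z : ℂ} (hz : z ≠ 0) {j : ℕ}
    (h1 : |arg (z / gapDir n)| < sunAngle n) (h2 : |arg (z / armDir n j)| < sunAngle n) :
    False := by
  have h := pow_mul_exp_eq (n := n) (norm_armDir n j) (norm_gapDir n) hz
  have h3 := abs_mul_sub_lt hn h2 h1
  rw [armDir_pow hn, gapDir_pow hn, one_mul] at h
  have h4 := congrArg arg h
  rw [arg_neg_one, arg_exp_mul_I, (toIocMod_eq_self _).2] at h4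
  · rw [h4, abs_of_pos Real.pi_pos] at h3
    exact h3.ne rfl
  · rw [abs_lt] at h3
    constructor <;> linarith

theorem near_armDir_unique (hn : 1 ≤ n) {z : ℂ} (hz : z ≠ 0) {i j : ℕ}
    (h1 : |arg (z / armDir n i)| < sunAngle n) (h2 : |arg (z / armDir n j)| < sunAngle n) :
    armDir n i = armDir n j := by
  have h := pow_mul_exp_eq (n := n) (norm_armDir n i) (norm_armDir n j) hz
  have h3 := abs_mul_sub_lt hn h1 h2
  rw [armDir_pow hn, armDir_pow hn, one_mul] at h
  have h4 := congrArg arg h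
  rw [arg_one, arg_exp_mul_I, (toIocMod_eq_self _).2] at h4
  · have h0 : (n : ℝ) ≠ 0 := by exact_mod_cast (by lia : n ≠ 0)
    have h5 : arg (z / armDir n i) = arg (z / armDir n j) := by
      linarith [(mul_eq_zero.1 h4).resolve_left h0]
    have h6 := mul_exp_arg_div_eq (norm_armDir n i) (norm_armDir n j) hz
    rw [h5] at h6
    exact mul_right_cancel₀ (exp_ne_zero _) h6
  · rw [abs_lt] at h3
    constructor <;> linarith

theorem arg_div_armDir_eq_zero {z : ℂ} {j : ℕ} (h : z = ‖z‖ * armDir n j) :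
    arg (z / armDir n j) = 0 := by
  rw [h, mul_div_cancel_right₀ _ (armDir_ne_zero n j), arg_ofReal_of_nonneg (norm_nonneg _)]

theorem Lsun.arg_div_armDir_eq_zero (hn : 1 ≤ n) {z : ℂ} (hz : z ∈ Lsun n) (h1 : 1 < ‖z‖) {j : ℕ}
    (h : |arg (z / armDir n j)| < sunAngle n) : arg (z / armDir n j) = 0 := by
  rcases Lsun.cases hz with h' | ⟨i, -, -, -, hi⟩
  · exact absurd h' h1.ne'
  · have h0 := _root_.arg_div_armDir_eq_zero hi
    have h1 : |arg (z / armDir n i)| < sunAngle n := by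
      rw [h0, abs_zero]
      exact sunAngle_pos hn
    rw [← near_armDir_unique hn (Lsun.ne_zero hz) h1 h, h0]

theorem abs_arg_neg_eq {z : ℂ} (hz : z ≠ 0) : |arg (-z)| = π - |arg z| := by
  rcases lt_trichotomy z.im 0 with h | h | h
  · rw [arg_neg_eq_arg_add_pi_of_im_neg h, abs_of_neg (arg_neg_iff.2 h),
      abs_of_pos (by linarith [neg_pi_lt_arg z])]
    ring
  · obtain ⟨r, rfl⟩ : ∃ r : ℝ, z = r := ⟨z.re, by rw [← conj_eq_iff_re.1 (conj_eq_iff_im.2 h)]; simp⟩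
    rcases lt_trichotomy r 0 with hr | rfl | hr
    · rw [← ofReal_neg, arg_ofReal_of_nonneg (by linarith), arg_ofReal_of_neg hr,
        abs_of_pos Real.pi_pos]
      simp
    · simp at hz
    · rw [← ofReal_neg, arg_ofReal_of_neg (by linarith), arg_ofReal_of_nonneg hr.le,
        abs_of_pos Real.pi_pos]
      simp
  · rw [arg_neg_eq_arg_sub_pi_of_im_pos h, abs_of_nonneg (arg_nonneg_iff.2 h.le),
      abs_of_nonpos (by linarith [arg_le_pi z])]
    ring

theorem abs_arg_div_neg {a z : ℂ} (ha : a ≠ 0) (hz : z ≠ 0) :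
    |arg (z / -a)| = π - |arg (z / a)| := by
  rw [div_neg, abs_arg_neg_eq (div_ne_zero hz ha)]

theorem arg_div_eq_arg_div_iff {a b x y : ℂ} (ha : ‖a‖ = 1) (hb : ‖b‖ = 1) (hx : x ≠ 0)
    (hy : y ≠ 0) : arg (x / a) = arg (y / a) ↔ arg (x / b) = arg (y / b) := by
  have key : ∀ c : ℂ, ‖c‖ = 1 → (arg (x / c) = arg (y / c) ↔ (‖y‖ / ‖x‖ : ℂ) * x = y) := by
    intro c hc
    have hc0 : c ≠ 0 := norm_ne_zero_iff.1 (by simp [hc])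
    rw [arg_eq_arg_iff (div_ne_zero hx hc0) (div_ne_zero hy hc0), norm_div, norm_div, hc, div_one,
      div_one, ← mul_div_assoc, div_left_inj' hc0]
  rw [key a ha, key b hb]

/-- The pairs of points of the sun graph whose angles with respect to `a` and `b` lie in `C` and
whose moduli lie in `Q`. -/
def sunPairs (n : ℕ) (a b : ℂ) (C Q : Set (ℝ × ℝ)) : Set (Lsun n × Lsun n) :=
  {p | ((p.1 : ℂ), (p.2 : ℂ)) ∈ polarSet a b C Q}

theorem mem_sunPairs {a b : ℂ} {C Q : Set (ℝ × ℝ)} {x y : Lsun n} :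
    (x, y) ∈ sunPairs n a b C Q ↔
      (arg (x / a), arg (y / b)) ∈ C ∧ (‖(x : ℂ)‖, ‖(y : ℂ)‖) ∈ Q :=
  ⟨fun h => h.2.2, fun h => ⟨Lsun.ne_zero x.2, Lsun.ne_zero y.2, h⟩⟩

theorem isOpen_sunPairs {a b : ℂ} (ha : a ≠ 0) (hb : b ≠ 0) {C Q : Set (ℝ × ℝ)} (hC : IsOpen C)
    (hQ : IsOpen Q) (hCπ : ∀ c ∈ C, |c.1| < π ∧ |c.2| < π) : IsOpen (sunPairs n a b C Q) :=
  (isOpen_polarSet ha hb hC hQ hCπ).preimage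
    (continuous_subtype_val.prodMap continuous_subtype_val)

theorem isSimplyConnected_sunPairs {a b : ℂ} {C Q : Set (ℝ × ℝ)}
    (h : IsSimplyConnected (Lsun n ×ˢ Lsun n ∩ polarSet a b C Q)) :
    IsSimplyConnected (sunPairs n a b C Q) := by
  have he : IsEmbedding (Prod.map Subtype.val Subtype.val : Lsun n × Lsun n → ℂ × ℂ) :=
    IsEmbedding.subtypeVal.prodMap IsEmbedding.subtypeVal
  rw [← he.isSimplyConnected_image]
  convert h using 1
  ext ⟨x, y⟩
  constructor
  · rintro ⟨⟨u, v⟩, h, he⟩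
    obtain ⟨rfl, rfl⟩ := Prod.mk.inj he
    exact ⟨⟨u.2, v.2⟩, h⟩
  · rintro ⟨⟨hx, hy⟩, h⟩
    exact ⟨(⟨x, hx⟩, ⟨y, hy⟩), h, rfl⟩

theorem norm_mul_mul_exp {a : ℂ} (ha : ‖a‖ = 1) {r : ℝ} (hr : 0 < r) (c : ℝ) :
    ‖(r : ℂ) * a * exp (c * I)‖ = r := by
  rw [norm_mul, norm_mul, ha, norm_exp_ofReal_mul_I, norm_real, Real.norm_of_nonneg hr.le, mul_one,
    mul_one]

/-- A configuration chart without restriction on the moduli retracts onto the configurations on the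
unit circle. -/
theorem isSimplyConnected_sunPairs_univ {a b : ℂ} (ha : ‖a‖ = 1) (hb : ‖b‖ = 1)
    {C : Set (ℝ × ℝ)} (hC : Convex ℝ C) (hne : C.Nonempty)
    (hCπ : ∀ c ∈ C, |c.1| < π ∧ |c.2| < π) : IsSimplyConnected (sunPairs n a b C univ) := by
  have ha0 : a ≠ 0 := norm_ne_zero_iff.1 (by simp [ha])
  have hb0 : b ≠ 0 := norm_ne_zero_iff.1 (by simp [hb])
  refine isSimplyConnected_sunPairs (isSimplyConnected_of_polar ha hb one_pos one_pos hC hne hCπ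
    (fun p hp => ⟨hp.2.1, hp.2.2.1, hp.2.2.2.1⟩) (fun c hc => ?_) fun p hp t ht => ?_)
  · have h1 := norm_mul_mul_exp ha one_pos c.1
    have h2 := norm_mul_mul_exp hb one_pos c.2
    refine ⟨⟨Lsun.mem_of_norm_eq_one h1, Lsun.mem_of_norm_eq_one h2⟩,
      norm_ne_zero_iff.1 (by rw [h1]; simp), norm_ne_zero_iff.1 (by rw [h2]; simp), ?_, trivial⟩
    rw [arg_mul_mul_exp_div ha0 one_pos (hCπ c hc).1, arg_mul_mul_exp_div hb0 one_pos (hCπ c hc).2]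
    exact hc
  · obtain ⟨⟨h1, h2⟩, h3, h4, h5, -⟩ := hp
    have p1 := radial_pos h3 one_pos ht
    have p2 := radial_pos h4 one_pos ht
    refine ⟨⟨Lsun.radial_mem h1 ht, Lsun.radial_mem h2 ht⟩, smul_ne_zero p1.ne' h3,
      smul_ne_zero p2.ne' h4, ?_, trivial⟩
    rw [arg_smul_div p1, arg_smul_div p2]
    exact h5

/-- The pairs of moduli `(r, s)` of which the second is larger. -/
def armModuli : Set (ℝ × ℝ) := {q | 1 < q.2 ∧ q.1 < q.2}

/-- The configurations with one point on the `j`-th arm and a point of smaller modulus close to that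
arm retract onto an interval. -/
theorem isSimplyConnected_sunPairs_armDir (hn : 1 ≤ n) {j : ℕ} (hj : j < n) {l u : ℝ} (hlu : l < u)
    (hl : -sunAngle n ≤ l) (hu : u ≤ sunAngle n) :
    IsSimplyConnected (sunPairs n (armDir n j) (armDir n j)
      (Ioo l u ×ˢ Ioo (-sunAngle n) (sunAngle n)) armModuli) := by
  have ha := norm_armDir n j
  have ha0 := armDir_ne_zero n j
  have hε := sunAngle_pos hn
  have hε' := sunAngle_le hn
  have hCπ : ∀ c ∈ Ioo l u ×ˢ ({0} : Set ℝ), |c.1| < π ∧ |c.2| < π := by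
    rintro ⟨c, d⟩ ⟨⟨h1, h2⟩, h3⟩
    obtain rfl : d = 0 := h3
    dsimp only at h1 h2
    refine ⟨abs_lt.2 ⟨?_, ?_⟩, by simpa using Real.pi_pos⟩ <;> linarith [Real.pi_pos]
  refine isSimplyConnected_sunPairs (isSimplyConnected_of_polar (r₁ := 1) (r₂ := 2) ha ha one_pos
    two_pos (C := Ioo l u ×ˢ {0}) ((convex_Ioo l u).prod (convex_singleton 0))
    ((nonempty_Ioo.2 hlu).prod (singleton_nonempty 0)) hCπ
    (fun p hp => ⟨hp.2.1, hp.2.2.1, ?_⟩) (fun c hc => ?_) fun p hp t ht => ?_)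
  · obtain ⟨⟨-, h2⟩, -, -, ⟨h5, h6⟩, h7, -⟩ := hp
    exact ⟨h5, Lsun.arg_div_armDir_eq_zero hn h2 h7 (abs_lt.2 h6)⟩
  · have h1 := norm_mul_mul_exp ha one_pos c.1
    have h2 := norm_mul_mul_exp ha two_pos c.2
    have h3 : c.2 = 0 := hc.2
    refine ⟨⟨Lsun.mem_of_norm_eq_one h1, ?_⟩, norm_ne_zero_iff.1 (by rw [h1]; simp),
      norm_ne_zero_iff.1 (by rw [h2]; simp), ?_, ?_⟩
    · rw [h3]
      simpa using smul_armDir_mem hj one_le_two le_rfl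
    · rw [arg_mul_mul_exp_div ha0 one_pos (hCπ c hc).1, arg_mul_mul_exp_div ha0 two_pos (hCπ c hc).2]
      refine ⟨hc.1, ?_⟩
      rw [h3]
      constructor <;> linarith
    · rw [h1, h2]
      constructor <;> norm_num
  · obtain ⟨⟨h1, h2⟩, h3, h4, h5, h6, h7⟩ := hp
    have p1 := radial_pos h3 one_pos ht
    have p2 := radial_pos h4 two_pos ht
    refine ⟨⟨Lsun.radial_mem h1 ht, Lsun.radial_mem_of_one_lt h2 h6 ht⟩, smul_ne_zero p1.ne' h3,
      smul_ne_zero p2.ne' h4, ?_, ?_⟩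
    · rw [arg_smul_div p1, arg_smul_div p2]
      exact h5
    · rw [norm_radial h3 one_pos ht, norm_radial h4 two_pos ht]
      obtain ⟨t0, t1⟩ := ht
      dsimp only at h6 h7
      rcases t0.eq_or_lt with rfl | t0
      · constructor <;> simpa
      · constructor
        · change 1 < (1 - t) * ‖p.2‖ + t * 2
          nlinarith
        · change (1 - t) * ‖p.1‖ + t * 1 < (1 - t) * ‖p.2‖ + t * 2
          nlinarith


/-- The pairs of points away from the direction `gapDir n`, ordered by their angles. -/
def sunSlit (n : ℕ) : Set (Lsun n × Lsun n) :=
  sunPairs n (-gapDir n) (-gapDir n) {c | |c.1| < π ∧ |c.2| < π ∧ c.1 < c.2} univ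

/-- The direction near which a handle is attached. -/
def handleDir (n : ℕ) (k : Option (Fin n)) : ℂ :=
  k.elim (gapDir n) fun j => armDir n j

/-- The pairs `(x, y)` with `x` at an angle between `l` and `u` from `handleDir n k`, such that
`y` is farther away from that direction (if `k = none`), or such that `y` is on the corresponding
arm and has larger modulus (if `k = some j`). -/
def sunHandle (n : ℕ) (k : Option (Fin n)) (l u : ℝ) : Set (Lsun n × Lsun n) :=
  k.elim (sunPairs n (gapDir n) (-gapDir n) {c | c.1 ∈ Ioo l u ∧ |c.1| + |c.2| < π} univ)
    fun j => sunPairs n (armDir n j) (armDir n j)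
      (Ioo l u ×ˢ Ioo (-sunAngle n) (sunAngle n)) armModuli

theorem abs_convexComb_le {a b : ℝ} (ha : 0 ≤ a) (hb : 0 ≤ b) (x y : ℝ) :
    |a * x + b * y| ≤ a * |x| + b * |y| := by
  have := abs_add_le (a * x) (b * y)
  rwa [abs_mul, abs_mul, abs_of_nonneg ha, abs_of_nonneg hb] at this

theorem convexComb_lt {a b x y r s : ℝ} (ha : 0 ≤ a) (hb : 0 ≤ b) (hab : a + b = 1) (hx : x < r)
    (hy : y < s) : a * x + b * y < a * r + b * s := by
  rcases ha.eq_or_lt with rfl | h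
  · have : b = 1 := by linarith
    subst this
    linarith
  · nlinarith

theorem isOpen_sunSlit : IsOpen (sunSlit n) := by
  refine isOpen_sunPairs (neg_ne_zero.2 (gapDir_ne_zero n)) (neg_ne_zero.2 (gapDir_ne_zero n)) ?_
    isOpen_univ fun c hc => ⟨hc.1, hc.2.1⟩
  exact (isOpen_lt continuous_fst.abs continuous_const).inter
    ((isOpen_lt continuous_snd.abs continuous_const).inter
      (isOpen_lt continuous_fst continuous_snd))

theorem isSimplyConnected_sunSlit : IsSimplyConnected (sunSlit n) := by
  have h : ‖-gapDir n‖ = 1 := by rw [norm_neg, norm_gapDir]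
  refine isSimplyConnected_sunPairs_univ h h ?_ ⟨(0, 1), ?_⟩ fun c hc => ⟨hc.1, hc.2.1⟩
  · rintro ⟨x, y⟩ ⟨h1, h2, h3⟩ ⟨z, w⟩ ⟨h4, h5, h6⟩ a b ha hb hab
    have e1 := convexComb_lt ha hb hab h1 h4
    have e2 := convexComb_lt ha hb hab h2 h5
    rw [← add_mul, hab, one_mul] at e1 e2
    exact ⟨(abs_convexComb_le ha hb _ _).trans_lt e1, (abs_convexComb_le ha hb _ _).trans_lt e2,
      convexComb_lt ha hb hab h3 h6⟩
  · refine ⟨by simpa using Real.pi_pos, ?_, zero_lt_one⟩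
    rw [abs_one]
    linarith [Real.pi_gt_three]

theorem sunSlit_asymm (x y : Lsun n) (h : (x, y) ∈ sunSlit n) : (y, x) ∉ sunSlit n :=
  fun h' => lt_asymm (mem_sunPairs.1 h).1.2.2 (mem_sunPairs.1 h').1.2.2

theorem mem_sunSlit_or {x y : Lsun n} : (x, y) ∈ sunSlit n ∨ (y, x) ∈ sunSlit n ↔
    arg (x / gapDir n) ≠ 0 ∧ arg (y / gapDir n) ≠ 0 ∧
      arg (x / gapDir n) ≠ arg (y / gapDir n) := by
  have h : ‖-gapDir n‖ = 1 := by rw [norm_neg, norm_gapDir]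
  have e1 := arg_div_eq_arg_div_iff h (norm_gapDir n) (Lsun.ne_zero x.2) (Lsun.ne_zero y.2)
  have e2 := abs_arg_div_neg (gapDir_ne_zero n) (Lsun.ne_zero x.2)
  have e3 := abs_arg_div_neg (gapDir_ne_zero n) (Lsun.ne_zero y.2)
  simp only [sunSlit, mem_sunPairs, mem_ofPred_eq, mem_univ, and_true]
  rw [e2, e3, sub_lt_self_iff, sub_lt_self_iff, abs_pos, abs_pos, ← e1.ne,
    ne_iff_lt_or_gt (a := arg (x / -gapDir n))]
  tauto

theorem isOpen_sunHandle (hn : 1 ≤ n) (k : Option (Fin n)) {l u : ℝ} (hl : -sunAngle n ≤ l)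
    (hu : u ≤ sunAngle n) : IsOpen (sunHandle n k l u) := by
  rcases k with _ | j
  · refine isOpen_sunPairs (gapDir_ne_zero n) (neg_ne_zero.2 (gapDir_ne_zero n)) ?_
      isOpen_univ fun c hc => ?_
    · exact (isOpen_Ioo.preimage continuous_fst).inter
        (isOpen_lt (continuous_fst.abs.add continuous_snd.abs) continuous_const)
    · have := hc.2
      constructor <;> linarith [abs_nonneg c.1, abs_nonneg c.2]
  · refine isOpen_sunPairs (armDir_ne_zero n j) (armDir_ne_zero n j) (isOpen_Ioo.prod isOpen_Ioo)
      ?_ fun c hc => ?_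
    · exact (isOpen_lt continuous_const continuous_snd).inter
        (isOpen_lt continuous_fst continuous_snd)
    · have := sunAngle_le hn
      obtain ⟨⟨h1, h2⟩, h3, h4⟩ := hc
      constructor <;> rw [abs_lt] <;> constructor <;> linarith [Real.pi_pos]

theorem isSimplyConnected_sunHandle (hn : 1 ≤ n) (k : Option (Fin n)) {l u : ℝ} (hlu : l < u)
    (hl : -sunAngle n ≤ l) (hu : u ≤ sunAngle n) : IsSimplyConnected (sunHandle n k l u) := by
  rcases k with _ | j
  · refine isSimplyConnected_sunPairs_univ (norm_gapDir n) (by rw [norm_neg, norm_gapDir]) ?_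
      ⟨((l + u) / 2, 0), ?_⟩ fun c hc => ?_
    · rintro ⟨x, y⟩ ⟨h1, h2⟩ ⟨z, w⟩ ⟨h3, h4⟩ a b ha hb hab
      refine ⟨convex_Ioo l u h1 h3 ha hb hab, ?_⟩
      have e := convexComb_lt ha hb hab h2 h4
      rw [← add_mul, hab, one_mul] at e
      have e1 := abs_convexComb_le ha hb x z
      have e2 := abs_convexComb_le ha hb y w
      change |a * x + b * z| + |a * y + b * w| < π
      dsimp only at e
      linarith
    · have := sunAngle_le hn
      have h : |(l + u) / 2| < π := by
        rw [abs_lt]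
        constructor <;> linarith [Real.pi_pos]
      exact ⟨⟨by dsimp only; linarith, by dsimp only; linarith⟩, by simpa using h⟩
    · have := hc.2
      constructor <;> linarith [abs_nonneg c.1, abs_nonneg c.2]
  · exact isSimplyConnected_sunPairs_armDir hn j.2 hlu hl hu

theorem mem_sunHandle_none {x y : Lsun n} {l u : ℝ} : (x, y) ∈ sunHandle n none l u ↔
    arg (x / gapDir n) ∈ Ioo l u ∧ |arg (x / gapDir n)| < |arg (y / gapDir n)| := by
  have e := abs_arg_div_neg (gapDir_ne_zero n) (Lsun.ne_zero y.2)
  simp only [sunHandle, Option.elim_none, mem_sunPairs, mem_ofPred_eq, mem_univ, and_true, e]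
  refine and_congr_right fun _ => ?_
  constructor <;> intro h <;> linarith

theorem mem_sunHandle_some {x y : Lsun n} {j : Fin n} {l u : ℝ} :
    (x, y) ∈ sunHandle n (some j) l u ↔ arg (x / armDir n j) ∈ Ioo l u ∧
      |arg (y / armDir n j)| < sunAngle n ∧ 1 < ‖(y : ℂ)‖ ∧ ‖(x : ℂ)‖ < ‖(y : ℂ)‖ := by
  simp only [sunHandle, Option.elim_some, mem_sunPairs, armModuli, mem_ofPred_eq, mem_prod,
    abs_lt, mem_Ioo (a := -sunAngle n), and_assoc]

theorem mem_sunHandle_iff {k : Option (Fin n)} {x y : Lsun n} {l u : ℝ} (hl : -sunAngle n ≤ l)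
    (hu : u ≤ sunAngle n) : (x, y) ∈ sunHandle n k l u ↔
      (x, y) ∈ sunHandle n k (-sunAngle n) (sunAngle n) ∧ arg (x / handleDir n k) ∈ Ioo l u := by
  have : arg (x / handleDir n k) ∈ Ioo l u →
      arg (x / handleDir n k) ∈ Ioo (-sunAngle n) (sunAngle n) := fun h => Ioo_subset_Ioo hl hu h
  rcases k with _ | j
  · rw [mem_sunHandle_none, mem_sunHandle_none]
    change arg (x / gapDir n) ∈ Ioo l u → arg (x / gapDir n) ∈ _ at this
    change _ ↔ _ ∧ arg (x / gapDir n) ∈ Ioo l u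
    tauto
  · rw [mem_sunHandle_some, mem_sunHandle_some]
    change arg (x / armDir n j) ∈ Ioo l u → arg (x / armDir n j) ∈ _ at this
    change _ ↔ _ ∧ arg (x / armDir n j) ∈ Ioo l u
    tauto

theorem sunHandle_asymm {k : Option (Fin n)} {l u : ℝ} (x y : Lsun n)
    (h : (x, y) ∈ sunHandle n k l u) : (y, x) ∉ sunHandle n k l u := by
  intro h'
  rcases k with _ | j
  · exact lt_asymm (mem_sunHandle_none.1 h).2 (mem_sunHandle_none.1 h').2
  · exact lt_asymm (mem_sunHandle_some.1 h).2.2.2 (mem_sunHandle_some.1 h').2.2.2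

theorem mem_sunSlit_or_iff_of_mem_sunHandle (hn : 1 ≤ n) {k : Option (Fin n)} {x y : Lsun n}
    (h : (x, y) ∈ sunHandle n k (-sunAngle n) (sunAngle n)) :
    ((x, y) ∈ sunSlit n ∨ (y, x) ∈ sunSlit n) ↔ arg (x / handleDir n k) ≠ 0 := by
  have hx := Lsun.ne_zero x.2
  have hy := Lsun.ne_zero y.2
  rw [mem_sunSlit_or]
  rcases k with _ | j
  · obtain ⟨h1, h2⟩ := mem_sunHandle_none.1 h
    change _ ↔ arg (x / gapDir n) ≠ 0
    refine ⟨fun h => h.1, fun h => ⟨h, ?_, fun h' => h2.ne (congrArg _ h')⟩⟩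
    exact abs_pos.1 ((abs_nonneg _).trans_lt h2)
  · obtain ⟨h1, h2, h3, h4⟩ := mem_sunHandle_some.1 h
    change _ ↔ arg (x / armDir n j) ≠ 0
    have far : ∀ z : Lsun n, |arg (z / armDir n j)| < sunAngle n → arg (z / gapDir n) ≠ 0 :=
      fun z hz h0 => not_near_gapDir_and_armDir hn (Lsun.ne_zero z.2)
        (by rw [h0, abs_zero]; exact sunAngle_pos hn) hz
    have e := arg_div_eq_arg_div_iff (norm_gapDir n) (norm_armDir n j) hx hy
    rw [Lsun.arg_div_armDir_eq_zero hn y.2 h3 h2] at e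
    rw [Ne, Ne, Ne, e]
    exact ⟨fun h => h.2.2, fun h => ⟨far x (abs_lt.2 h1), far y h2, h⟩⟩

theorem sunHandle_disjoint_aux (hn : 1 ≤ n) {j : Fin n} {k : Option (Fin n)} {x y : Lsun n}
    (hk : k ≠ some j) (h : (x, y) ∈ sunHandle n (some j) (-sunAngle n) (sunAngle n)) :
    (x, y) ∉ sunHandle n k (-sunAngle n) (sunAngle n) ∧
      (y, x) ∉ sunHandle n k (-sunAngle n) (sunAngle n) := by
  have hx := Lsun.ne_zero x.2
  have hy := Lsun.ne_zero y.2
  obtain ⟨h1, h2, h3, h4⟩ := mem_sunHandle_some.1 h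
  rcases k with _ | i
  · constructor <;> intro h' <;> rw [mem_sunHandle_none] at h'
    · exact not_near_gapDir_and_armDir hn hx (abs_lt.2 h'.1) (abs_lt.2 h1)
    · exact not_near_gapDir_and_armDir hn hy (abs_lt.2 h'.1) h2
  · constructor <;> intro h' <;> rw [mem_sunHandle_some] at h'
    · exact hk (congrArg some (Fin.ext
        (armDir_injective hn i.2 j.2 (near_armDir_unique hn hy h'.2.1 h2))))
    · exact lt_asymm h'.2.2.2 h4

theorem sunHandle_disjoint (hn : 1 ≤ n) {i k : Option (Fin n)} (hik : i ≠ k) :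
    Disjoint (UConf.ofRel (sunHandle n i (-sunAngle n) (sunAngle n)))
      (UConf.ofRel (sunHandle n k (-sunAngle n) (sunAngle n))) := by
  rcases i with _ | i
  · rcases k with _ | k
    · exact absurd rfl hik
    · exact (UConf.disjoint_ofRel fun x y h => sunHandle_disjoint_aux hn hik h).symm
  · exact UConf.disjoint_ofRel fun x y h => sunHandle_disjoint_aux hn hik.symm h

theorem sunSlit_or_sunHandle (hn : 1 ≤ n) (s : UConf 2 (Lsun n)) :
    s ∈ UConf.ofRel (sunSlit n) ∨
      ∃ k, s ∈ UConf.ofRel (sunHandle n k (-sunAngle n) (sunAngle n)) := by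
  obtain ⟨x, y, hxy, rfl⟩ := s.exists_eq_pair
  simp only [UConf.pair_mem_ofRel]
  have hε := sunAngle_pos hn
  have arm : ∀ x y : Lsun n, arg (x / gapDir n) = arg (y / gapDir n) → ‖(x : ℂ)‖ < ‖(y : ℂ)‖ →
      ∃ k, (x, y) ∈ sunHandle n k (-sunAngle n) (sunAngle n) := by
    intro x y h hlt
    have h1 : 1 < ‖(y : ℂ)‖ := (Lsun.one_le_norm x.2).trans_lt hlt
    rcases Lsun.cases y.2 with h' | ⟨j, hj, -, -, hj'⟩
    · exact absurd h' h1.ne'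
    · have h0 := arg_div_armDir_eq_zero hj'
      refine ⟨some ⟨j, hj⟩, mem_sunHandle_some.2 ⟨?_, ?_, h1, hlt⟩⟩
      · rw [(arg_div_eq_arg_div_iff (norm_gapDir n) (norm_armDir n j) (Lsun.ne_zero x.2)
          (Lsun.ne_zero y.2)).1 h, h0]
        exact ⟨by linarith, hε⟩
      · rwa [h0, abs_zero]
  by_cases h : arg (x / gapDir n) = arg (y / gapDir n)
  · right
    rcases lt_trichotomy ‖(x : ℂ)‖ ‖(y : ℂ)‖ with hlt | heq | hlt
    · exact (arm x y h hlt).imp fun _ => Or.inl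
    · refine absurd (Subtype.ext ?_) hxy
      have e1 := norm_mul_exp_arg_div (z := (x : ℂ)) (norm_gapDir n)
      rw [← e1, h, heq, norm_mul_exp_arg_div (norm_gapDir n)]
    · exact (arm y x h.symm hlt).imp fun _ => Or.inr
  · by_cases hx : arg (x / gapDir n) = 0
    · refine Or.inr ⟨none, Or.inl (mem_sunHandle_none.2 ?_)⟩
      rw [hx, abs_zero, abs_pos]
      exact ⟨⟨by linarith, hε⟩, fun h' => h (hx.trans h'.symm)⟩
    · by_cases hy : arg (y / gapDir n) = 0
      · refine Or.inr ⟨none, Or.inr (mem_sunHandle_none.2 ?_)⟩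
        rw [hy, abs_zero, abs_pos]
        exact ⟨⟨by linarith, hε⟩, hx⟩
      · exact Or.inl (mem_sunSlit_or.2 ⟨hx, hy, h⟩)

end Sun

/-- the 2-string braid group of the n-ray sun graph `Lₙ`
is free of rank `n+1`, for all `n ≥ 1` and any base configuration. -/
theorem braid_two_nRaySun_free (n : ℕ) (hn : 1 ≤ n) (c : UConf 2 ↥(Lsun n)) :
    Nonempty (FundamentalGroup (UConf 2 ↥(Lsun n)) c ≃* FreeGroup (Fin (n + 1))) := by
  have hε := sunAngle_pos hn
  have hε' : -sunAngle n ≤ 0 := by linarith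
  have hP := fun k (x y : Lsun n) =>
    mem_sunHandle_iff (k := k) (x := x) (y := y) hε' le_rfl
  have hN := fun k (x y : Lsun n) =>
    mem_sunHandle_iff (k := k) (x := x) (y := y) le_rfl hε.le
  have sc : ∀ k {l u : ℝ}, l < u → -sunAngle n ≤ l → u ≤ sunAngle n →
      IsSimplyConnected (UConf.ofRel (sunHandle n k l u)) := fun k l u hlu hl hu =>
    UConf.isSimplyConnected_ofRel (isOpen_sunHandle hn k hl hu) sunHandle_asymm
      (isSimplyConnected_sunHandle hn k hlu hl hu)
  obtain ⟨e⟩ := nonempty_fundamentalGroup_mulEquiv_freeGroup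
    (U := UConf.ofRel (sunSlit n))
    (V := fun k => UConf.ofRel (sunHandle n k (-sunAngle n) (sunAngle n)))
    (P := fun k => UConf.ofRel (sunHandle n k 0 (sunAngle n)))
    (N := fun k => UConf.ofRel (sunHandle n k (-sunAngle n) 0))
    (UConf.isOpen_ofRel isOpen_sunSlit)
    (fun k => UConf.isOpen_ofRel (isOpen_sunHandle hn k le_rfl le_rfl))
    (fun k => UConf.isOpen_ofRel (isOpen_sunHandle hn k hε' le_rfl))
    (fun k => UConf.isOpen_ofRel (isOpen_sunHandle hn k le_rfl hε.le))
    (UConf.isSimplyConnected_ofRel isOpen_sunSlit sunSlit_asymm isSimplyConnected_sunSlit)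
    (fun k => sc k (by linarith) le_rfl le_rfl)
    (fun k => (sc k hε hε' le_rfl).isPathConnected)
    (fun k => (sc k (by linarith) le_rfl hε.le).isPathConnected)
    (fun k => UConf.ofRel_inter_ofRel (fun p hp => ((hP k _ _).1 hp).1)
      (fun p hp => ((hN k _ _).1 hp).1) fun x y h => by
        rw [mem_sunSlit_or_iff_of_mem_sunHandle hn h, hP, hN]
        have h1 := ((mem_sunHandle_iff le_rfl le_rfl).1 h).2
        simp only [h, true_and, mem_Ioo, h1.1, h1.2, and_true]
        exact ne_iff_lt_or_gt.trans or_comm)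
    (fun k => UConf.disjoint_ofRel fun x y h => by
      rw [hP] at h
      rw [hN, hN]
      exact ⟨fun h' => lt_asymm h.2.1 h'.2.2, fun h' => sunHandle_asymm x y h.1 h'.1⟩)
    (fun i k hik => sunHandle_disjoint hn hik) (sunSlit_or_sunHandle hn) c
  exact ⟨e.trans (FreeGroup.freeGroupCongr (finSuccEquiv n).symm)⟩

end
end
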